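/- arXiv:0706.3500 — 2 statements merged into one kernel-verified Lean document; each statement's English description precedes it below -/
import Mathlib

section
/- Suppose 0 < β < 1 and h = 0, and define H := (1/N) Σ_{1≤i<j≤N} g_{ij} σ_i σ_j - √N β / 2. Then there exists a constant C depending only on β such that for every N ≥ 2 and every bounded measurable u : ℝ → ℝ, E( ⟨u(H)⟩ - ∫_ℝ u(t) φ_{0, 1/2}(t) dt )² ≤ C ‖u‖_∞² / N. In particular the quenched law of H is asymptotically Gaussian with mean 0 and variance 1/2, with total variation error bound of order 1/√N. -/
open MeasureTheory ProbabilityTheory Real Finset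

namespace SK

/-- Index set of pairs `i < j` in `Fin N`. -/
abbrev Pairs (N : ℕ) := {p : Fin N × Fin N // p.1 < p.2}

/-- The disorder: one real coordinate per pair. -/
abbrev Disorder (N : ℕ) := Pairs N → ℝ

/-- Law of the disorder: i.i.d. standard Gaussians. -/
noncomputable def μdis (N : ℕ) : Measure (Disorder N) :=
  Measure.pi fun _ => gaussianReal 0 1

/-- The symmetric extension `g_{ij}` of the disorder. -/
noncomputable def gval {N : ℕ} (G : Disorder N) (i j : Fin N) : ℝ :=
  if hij : i < j then G ⟨(i, j), hij⟩ else if hji : j < i then G ⟨(j, i), hji⟩ else 0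

abbrev Config (N : ℕ) := Fin N → Bool

/-- Spins `±1`. -/
def spin (b : Bool) : ℝ := if b then 1 else -1

/-- (Negative) Hamiltonian of the SK model. -/
noncomputable def ham {N : ℕ} (β h : ℝ) (G : Disorder N) (σ : Config N) : ℝ :=
  (β / Real.sqrt N) * ∑ p : Pairs N, G p * spin (σ p.1.1) * spin (σ p.1.2)
    + h * ∑ i, spin (σ i)

/-- Partition function. -/
noncomputable def Zpart {N : ℕ} (β h : ℝ) (G : Disorder N) : ℝ :=
  ∑ σ : Config N, Real.exp (ham β h G σ)

/-- Gibbs measure. -/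
noncomputable def gibbs {N : ℕ} (β h : ℝ) (G : Disorder N) (σ : Config N) : ℝ :=
  Real.exp (ham β h G σ) / Zpart β h G

/-- Quenched average of a function of one replica. -/
noncomputable def qavg {N : ℕ} (β h : ℝ) (G : Disorder N) (f : Config N → ℝ) : ℝ :=
  ∑ σ : Config N, f σ * gibbs β h G σ

/-- Quenched average of a function of two replicas. -/
noncomputable def qavg2 {N : ℕ} (β h : ℝ) (G : Disorder N)
    (f : Config N → Config N → ℝ) : ℝ :=
  ∑ σ1 : Config N, ∑ σ2 : Config N, f σ1 σ2 * gibbs β h G σ1 * gibbs β h G σ2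

/-- Overlap of two configurations. -/
noncomputable def overlap {N : ℕ} (σ1 σ2 : Config N) : ℝ :=
  (1 / (N : ℝ)) * ∑ i, spin (σ1 i) * spin (σ2 i)

/-- The high temperature condition `E⟨(R₁₂ - q)⁴⟩ ≤ K/N²`. -/
def highTemp (N : ℕ) (β h q K : ℝ) : Prop :=
  ∫ G, qavg2 β h G (fun σ1 σ2 => (overlap σ1 σ2 - q) ^ 4) ∂(μdis N) ≤ K / (N : ℝ) ^ 2

/-- Magnetization `⟨σ_i⟩`. -/
noncomputable def mavg {N : ℕ} (β h : ℝ) (G : Disorder N) (i : Fin N) : ℝ :=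
  qavg β h G fun σ => spin (σ i)

/-- Local field `ℓ_i`. -/
noncomputable def locField {N : ℕ} (G : Disorder N) (i : Fin N) (σ : Config N) : ℝ :=
  (1 / Real.sqrt N) * ∑ j ∈ Finset.univ.erase i, gval G i j * spin (σ j)

/-- The field `r_i`. -/
noncomputable def rfield {N : ℕ} (β h q : ℝ) (G : Disorder N) (i : Fin N) : ℝ :=
  (1 / Real.sqrt N) * ∑ j ∈ Finset.univ.erase i, gval G i j * mavg β h G j
    - β * (1 - q) * mavg β h G i

/-- Gaussian density `φ_{μ,v}` with mean `μ` and variance `v`. -/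
noncomputable def gaussDens (μ v x : ℝ) : ℝ :=
  (1 / (Real.sqrt (2 * π) * Real.sqrt v)) * Real.exp (-(x - μ) ^ 2 / (2 * v))

/-- Mixture-Gaussian density `ψ_{a,b,μ,v}`. -/
noncomputable def mixDens (a b μ v x : ℝ) : ℝ :=
  Real.cosh (a * x + b) * Real.exp (-(x - μ) ^ 2 / (2 * v)) /
    (Real.sqrt (2 * π) * Real.sqrt v * Real.cosh (a * μ + b) * Real.exp (a ^ 2 * v / 2))

/-! ### Gaussian integration on finite products -/

/-- The standard Gaussian measure on `ι → ℝ`. -/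
noncomputable abbrev gaussPi (ι : Type) [Fintype ι] : Measure (ι → ℝ) :=
  Measure.pi fun _ => gaussianReal 0 1

/-- Resampling one coordinate preserves the standard Gaussian measure. -/
theorem measurePreserving_update {ι : Type} [Fintype ι] [DecidableEq ι] (p : ι) :
    MeasurePreserving (fun z : (ι → ℝ) × ℝ => Function.update z.1 p z.2)
      ((gaussPi ι).prod (gaussianReal 0 1)) (gaussPi ι) := by
  have hm : Measurable (fun z : (ι → ℝ) × ℝ => Function.update z.1 p z.2) := by
    refine measurable_pi_lambda _ fun i => ?_
    by_cases h : i = p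
    · subst h; simpa using measurable_snd
    · simp only [Function.update_of_ne h]; fun_prop
  refine ⟨hm, (Measure.pi_eq fun t ht => ?_).symm⟩
  rw [Measure.map_apply hm (MeasurableSet.univ_pi ht)]
  have : (fun z : (ι → ℝ) × ℝ => Function.update z.1 p z.2) ⁻¹' Set.univ.pi t
      = (Set.univ.pi (Function.update t p Set.univ)) ×ˢ (t p) := by
    ext z
    simp only [Set.mem_preimage, Set.mem_pi, Set.mem_univ, true_implies, Set.mem_prod]
    constructor
    · intro h
      refine ⟨fun i => ?_, by simpa using h p⟩
      by_cases hi : i = p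
      · subst hi; simp
      · simpa [Function.update_of_ne hi] using h i
    · rintro ⟨h1, h2⟩ i
      by_cases hi : i = p
      · subst hi; simpa using h2
      · simpa [Function.update_of_ne hi] using h1 i
  rw [this, Measure.prod_prod, Measure.pi_pi, ← Finset.mul_prod_erase _ _ (Finset.mem_univ p),
    ← Finset.mul_prod_erase _ (fun i => gaussianReal 0 1 (t i)) (Finset.mem_univ p)]
  simp only [Function.update_self, measure_univ, one_mul]
  rw [mul_comm]
  congr 1
  refine Finset.prod_congr rfl fun i hi => ?_
  rw [Function.update_of_ne (Finset.ne_of_mem_erase hi)]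

theorem hasDerivAt_gaussianPDFReal (x : ℝ) :
    HasDerivAt (gaussianPDFReal 0 1) (-x * gaussianPDFReal 0 1 x) x := by
  have h : HasDerivAt (fun y : ℝ => -(y - 0) ^ 2 / (2 * ((1 : NNReal) : ℝ))) (-x) x := by
    have := ((hasDerivAt_id x).sub_const 0).pow 2 |>.neg |>.div_const (2 * ((1 : NNReal) : ℝ))
    refine this.congr_deriv ?_
    simp
    ring
  have := (h.exp).const_mul (√(2 * π * ((1 : NNReal) : ℝ)))⁻¹
  refine this.congr_deriv ?_
  simp only [gaussianPDFReal]
  ring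

theorem integrable_gaussianReal_iff {F : ℝ → ℝ} :
    Integrable F (gaussianReal 0 1) ↔ Integrable fun x => F x * gaussianPDFReal 0 1 x := by
  rw [gaussianReal_of_var_ne_zero 0 one_ne_zero,
    integrable_withDensity_iff_integrable_smul₀' (by fun_prop)
      (Filter.Eventually.of_forall fun _ => gaussianPDF_lt_top)]
  simp only [toReal_gaussianPDF, smul_eq_mul, mul_comm]

/-- Stein's lemma for the standard Gaussian measure on the line. -/
theorem integral_mul_gaussianReal {F F' : ℝ → ℝ} (hF : ∀ x, HasDerivAt F (F' x) x)
    (h0 : Integrable F (gaussianReal 0 1)) (h1 : Integrable (fun x => x * F x) (gaussianReal 0 1))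
    (h2 : Integrable F' (gaussianReal 0 1)) :
    ∫ x, x * F x ∂gaussianReal 0 1 = ∫ x, F' x ∂gaussianReal 0 1 := by
  rw [integrable_gaussianReal_iff] at h0 h1 h2
  have := integral_mul_deriv_eq_deriv_mul_of_integrable (u := F) (u' := F')
    (v := gaussianPDFReal 0 1) (v' := fun x => -x * gaussianPDFReal 0 1 x)
    (fun x _ => hF x) (fun x _ => hasDerivAt_gaussianPDFReal x)
    (by refine h1.neg.congr (Filter.Eventually.of_forall fun x => ?_)
        simp only [Pi.neg_apply, Pi.mul_apply]; ring) h2 h0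
  rw [integral_gaussianReal_eq_integral_smul one_ne_zero,
    integral_gaussianReal_eq_integral_smul one_ne_zero]
  simp only [smul_eq_mul]
  have h3 : ∀ x, gaussianPDFReal 0 1 x * (x * F x) = -(F x * (-x * gaussianPDFReal 0 1 x)) :=
    fun x => by ring
  simp_rw [h3, integral_neg, this, neg_neg, mul_comm]

/-- Gaussian integration by parts in one coordinate. -/
theorem integral_coord_mul {ι : Type} [Fintype ι] [DecidableEq ι] (p : ι) {F F' : (ι → ℝ) → ℝ}
    (hF : ∀ g x, HasDerivAt (fun y => F (Function.update g p y)) (F' (Function.update g p x)) x)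
    (h0 : Integrable F (gaussPi ι)) (h1 : Integrable (fun g => g p * F g) (gaussPi ι))
    (h2 : Integrable F' (gaussPi ι)) :
    ∫ g, g p * F g ∂gaussPi ι = ∫ g, F' g ∂gaussPi ι := by
  have hp := measurePreserving_update p
  have key : ∀ {H : (ι → ℝ) → ℝ}, Integrable H (gaussPi ι) →
      Integrable (fun z : (ι → ℝ) × ℝ => H (Function.update z.1 p z.2))
        ((gaussPi ι).prod (gaussianReal 0 1)) ∧
      ∫ g, H g ∂gaussPi ι
        = ∫ g, ∫ x, H (Function.update g p x) ∂gaussianReal 0 1 ∂gaussPi ι := by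
    intro H hH
    have hi : Integrable (fun z : (ι → ℝ) × ℝ => H (Function.update z.1 p z.2))
        ((gaussPi ι).prod (gaussianReal 0 1)) :=
      hp.integrable_comp_of_integrable hH
    refine ⟨hi, ?_⟩
    rw [← integral_prod _ hi]
    conv_lhs => rw [← hp.map_eq]
    rw [integral_map hp.measurable.aemeasurable (by rw [hp.map_eq]; exact hH.aestronglyMeasurable)]
  rw [(key h1).2, (key h2).2]
  refine integral_congr_ae ?_
  filter_upwards [(key h0).1.prod_right_ae, (key h1).1.prod_right_ae, (key h2).1.prod_right_ae]
    with g a0 a1 a2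
  simp only [Function.update_self] at a1 ⊢
  exact integral_mul_gaussianReal (hF g) a0 a1 a2

theorem integrable_coord_sq {ι : Type} [Fintype ι] (p : ι) :
    Integrable (fun g : ι → ℝ => g p ^ 2) (gaussPi ι) := by
  have h : Integrable (fun x : ℝ => x ^ 2) (gaussianReal 0 1) :=
    (memLp_id_gaussianReal 2).integrable_sq
  exact integrable_comp_eval (μ := fun _ : ι => gaussianReal 0 1) (i := p) h

/-- Continuous functions of at most quadratic growth are integrable. -/
theorem integrable_of_quadratic_growth {ι : Type} [Fintype ι] {F : (ι → ℝ) → ℝ}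
    (hF : Measurable F) (C : ℝ) (h : ∀ g, |F g| ≤ C * (1 + ∑ p, |g p|) ^ 2) :
    Integrable F (gaussPi ι) := by
  have hi : Integrable (fun g : ι → ℝ => |C| * ((1 + Fintype.card ι) * (1 + ∑ p, g p ^ 2)))
      (gaussPi ι) :=
    (((integrable_const 1).add (integrable_finsetSum _ fun p _ => integrable_coord_sq p)).const_mul
      _).const_mul _
  refine hi.mono' hF.aestronglyMeasurable (Filter.Eventually.of_forall fun g => ?_)
  have h1 : (1 + ∑ p, |g p|) ^ 2 ≤ (1 + Fintype.card ι) * (1 + ∑ p, g p ^ 2) := by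
    have := sq_sum_le_card_mul_sum_sq (s := (Finset.univ : Finset (Option ι)))
      (f := fun o => o.elim 1 fun p => |g p|)
    simpa [Fintype.sum_option, add_comm] using this
  calc ‖F g‖ ≤ C * (1 + ∑ p, |g p|) ^ 2 := h g
    _ ≤ |C| * (1 + ∑ p, |g p|) ^ 2 := by gcongr; exact le_abs_self C
    _ ≤ _ := by gcongr

theorem integrable_exp_linear {ι : Type} [Fintype ι] (a : ι → ℝ) :
    Integrable (fun g : ι → ℝ => exp (∑ p, g p * a p)) (gaussPi ι) := by
  simp_rw [exp_sum]
  refine Integrable.fintype_prod (f := fun p x => exp (x * a p)) fun p => ?_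
  simpa [mul_comm] using integrable_exp_mul_gaussianReal (μ := 0) (v := 1) (a p)

theorem integral_exp_linear {ι : Type} [Fintype ι] (a : ι → ℝ) :
    ∫ g : ι → ℝ, exp (∑ p, g p * a p) ∂gaussPi ι = exp ((∑ p, a p ^ 2) / 2) := by
  simp_rw [exp_sum]
  rw [integral_fintype_prod_eq_prod (fun p x => exp (x * a p)), sum_div, exp_sum]
  refine prod_congr rfl fun p _ => ?_
  have := congrFun (mgf_id_gaussianReal (μ := 0) (v := 1)) (a p)
  simpa [mgf, mul_comm] using this

/-! ### Gibbs weights on a finite set -/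

/-- The Gibbs weight of `σ` for the energies `e`. -/
noncomputable def gibbsWt {S : Type} [Fintype S] (e : S → ℝ) (σ : S) : ℝ :=
  exp (e σ) / ∑ τ, exp (e τ)

/-- The log-partition function for the energies `e`. -/
noncomputable def logPart {S : Type} [Fintype S] (e : S → ℝ) : ℝ :=
  log (∑ τ, exp (e τ))

theorem sum_exp_pos {S : Type} [Fintype S] [Nonempty S] (e : S → ℝ) : 0 < ∑ τ, exp (e τ) :=
  sum_pos (fun _ _ => exp_pos _) univ_nonempty

theorem gibbsWt_nonneg {S : Type} [Fintype S] (e : S → ℝ) (σ : S) : 0 ≤ gibbsWt e σ :=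
  div_nonneg (exp_pos _).le (sum_nonneg fun _ _ => (exp_pos _).le)

theorem sum_gibbsWt {S : Type} [Fintype S] [Nonempty S] (e : S → ℝ) : ∑ σ, gibbsWt e σ = 1 := by
  simp only [gibbsWt]
  rw [← sum_div, div_self (sum_exp_pos e).ne']

theorem gibbsWt_le_one {S : Type} [Fintype S] [Nonempty S] (e : S → ℝ) (σ : S) :
    gibbsWt e σ ≤ 1 := by
  rw [← sum_gibbsWt e]
  exact single_le_sum (fun τ _ => gibbsWt_nonneg e τ) (mem_univ σ)

theorem hasDerivAt_sum_exp {S : Type} [Fintype S] {e : ℝ → S → ℝ} {e' : S → ℝ} {x : ℝ}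
    (he : ∀ σ, HasDerivAt (fun y => e y σ) (e' σ) x) :
    HasDerivAt (fun y => ∑ σ, exp (e y σ)) (∑ σ, exp (e x σ) * e' σ) x :=
  HasDerivAt.fun_sum fun σ _ => (he σ).exp

theorem hasDerivAt_logPart {S : Type} [Fintype S] [Nonempty S] {e : ℝ → S → ℝ} {e' : S → ℝ}
    {x : ℝ} (he : ∀ σ, HasDerivAt (fun y => e y σ) (e' σ) x) :
    HasDerivAt (fun y => logPart (e y)) (∑ σ, gibbsWt (e x) σ * e' σ) x := by
  refine ((hasDerivAt_sum_exp he).log (sum_exp_pos _).ne').congr_deriv ?_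
  simp only [gibbsWt]
  rw [sum_div]
  exact sum_congr rfl fun σ _ => by ring

theorem hasDerivAt_gibbsWt {S : Type} [Fintype S] [Nonempty S] {e : ℝ → S → ℝ} {e' : S → ℝ}
    {x : ℝ} (he : ∀ σ, HasDerivAt (fun y => e y σ) (e' σ) x) (σ : S) :
    HasDerivAt (fun y => gibbsWt (e y) σ)
      (gibbsWt (e x) σ * (e' σ - ∑ τ, gibbsWt (e x) τ * e' τ)) x := by
  have hz := (sum_exp_pos (e x)).ne'
  refine ((he σ).exp.div (hasDerivAt_sum_exp he) hz).congr_deriv ?_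
  have : ∑ τ, gibbsWt (e x) τ * e' τ = (∑ τ, exp (e x τ) * e' τ) / ∑ τ, exp (e x τ) := by
    simp only [gibbsWt]
    rw [sum_div]
    exact sum_congr rfl fun σ _ => by ring
  rw [this]
  simp only [gibbsWt]
  field_simp

theorem exp_sum_mul_le {S : Type} [Fintype S] {w X : S → ℝ} (hw : ∀ σ, 0 ≤ w σ)
    (h1 : ∑ σ, w σ = 1) : exp (∑ σ, w σ * X σ) ≤ ∑ σ, w σ * exp (X σ) := by
  simpa using convexOn_exp.map_sum_le (t := univ) (w := w) (p := X) (fun σ _ => hw σ) h1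
    (fun _ _ => Set.mem_univ _)

/-- A logarithmic exponential moment controls the second moment. -/
theorem sum_mul_sq_le_of_log_moment {S : Type} [Fintype S] {w X : S → ℝ} (hw : ∀ σ, 0 ≤ w σ)
    (h1 : ∑ σ, w σ = 1) (hX : ∀ σ, -1 ≤ X σ) (h0 : 0 ≤ log (∑ σ, w σ * exp (X σ))) :
    ∑ σ, w σ * X σ ^ 2 ≤ 3 * (1 + log (∑ σ, w σ * exp (X σ))) ^ 2 := by
  set A := ∑ σ, w σ * exp (X σ) with hA
  have hApos : 0 < A := lt_of_lt_of_le (exp_pos _) (exp_sum_mul_le hw h1)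
  set ψ := log A with hψ
  have hpt : ∀ x : ℝ, -1 ≤ x → x ^ 2 ≤ (1 + ψ) ^ 2 * (1 + 2 * exp (x - ψ)) := by
    intro x hx
    rcases le_total x ψ with h | h
    · have : x ^ 2 ≤ (1 + ψ) ^ 2 := sq_le_sq' (by linarith) (by linarith)
      have h2 := mul_nonneg (sq_nonneg (1 + ψ)) (exp_pos (x - ψ)).le
      linarith
    · have h3 : x ^ 2 ≤ (1 + ψ) ^ 2 * (1 + (x - ψ)) ^ 2 := by
        rw [← mul_pow]
        refine pow_le_pow_left₀ (by linarith) ?_ 2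
        nlinarith
      have h4 := quadratic_le_exp_of_nonneg (sub_nonneg.2 h)
      refine h3.trans (mul_le_mul_of_nonneg_left ?_ (sq_nonneg _))
      nlinarith
  calc ∑ σ, w σ * X σ ^ 2
      ≤ ∑ σ, w σ * ((1 + ψ) ^ 2 * (1 + 2 * exp (X σ - ψ))) :=
        sum_le_sum fun σ _ => mul_le_mul_of_nonneg_left (hpt _ (hX σ)) (hw σ)
    _ = (1 + ψ) ^ 2 * (∑ σ, w σ + 2 * ((∑ σ, w σ * exp (X σ)) * exp (-ψ))) := by
        rw [sum_mul, mul_sum, ← sum_add_distrib, mul_sum]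
        refine sum_congr rfl fun σ _ => ?_
        rw [sub_eq_add_neg, exp_add]; ring
    _ = 3 * (1 + ψ) ^ 2 := by
        rw [h1, ← hA, exp_neg, hψ, exp_log hApos, mul_inv_cancel₀ hApos.ne']; ring

/-! ### Gaussian spin systems -/

section System

variable {ι S : Type}

theorem abs_coeff_eq_one {s : S → ι → ℝ} (hs : ∀ σ p, s σ p * s σ p = 1) (σ : S) (p : ι) :
    |s σ p| = 1 := by
  have := hs σ p
  rw [← abs_mul_abs_self] at this
  nlinarith [abs_nonneg (s σ p)]

variable [Fintype ι]

/-- The Gaussian energy of `σ` with coefficients `s σ`. -/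
noncomputable def energy (s : S → ι → ℝ) (g : ι → ℝ) (σ : S) : ℝ := ∑ p, g p * s σ p

/-- Covariance of the energies of `σ` and `τ`. -/
noncomputable def corr (s : S → ι → ℝ) (σ τ : S) : ℝ := ∑ p, s σ p * s τ p

theorem corr_comm (s : S → ι → ℝ) (σ τ : S) : corr s σ τ = corr s τ σ := by
  simp only [corr, mul_comm]

@[fun_prop]
theorem measurable_energy (s : S → ι → ℝ) (σ : S) : Measurable fun g => energy s g σ := by
  unfold energy; fun_prop

theorem hasDerivAt_energy_update [DecidableEq ι] (s : S → ι → ℝ) (g : ι → ℝ) (p : ι) (σ : S)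
    (x : ℝ) : HasDerivAt (fun y => energy s (Function.update g p y) σ) (s σ p) x := by
  have h : (fun y => energy s (Function.update g p y) σ)
      = fun y => y * s σ p + ∑ q ∈ univ.erase p, g q * s σ q := by
    funext y
    rw [energy, ← add_sum_erase _ _ (mem_univ p), Function.update_self]
    congr 1
    exact sum_congr rfl fun q hq => by rw [Function.update_of_ne (ne_of_mem_erase hq)]
  rw [h]
  simpa using ((hasDerivAt_id x).mul_const (s σ p)).add_const (∑ q ∈ univ.erase p, g q * s σ q)

theorem abs_corr_le {s : S → ι → ℝ} (hs : ∀ σ p, s σ p * s σ p = 1) (σ τ : S) :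
    |corr s σ τ| ≤ Fintype.card ι := by
  refine (abs_sum_le_sum_abs _ _).trans ?_
  simp [abs_mul, abs_coeff_eq_one hs]

theorem abs_energy_le {s : S → ι → ℝ} (hs : ∀ σ p, s σ p * s σ p = 1) (g : ι → ℝ) (σ : S) :
    |energy s g σ| ≤ ∑ p, |g p| := by
  refine (abs_sum_le_sum_abs _ _).trans ?_
  simp [abs_mul, abs_coeff_eq_one hs]

variable [Fintype S]

/-- Gibbs weight at inverse temperature `θ`. -/
noncomputable def wt (s : S → ι → ℝ) (θ : ℝ) (g : ι → ℝ) (σ : S) : ℝ :=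
  gibbsWt (fun τ => θ * energy s g τ) σ

/-- Quenched average of the coefficient `p`. -/
noncomputable def mag (s : S → ι → ℝ) (θ : ℝ) (g : ι → ℝ) (p : ι) : ℝ :=
  ∑ σ, wt s θ g σ * s σ p

/-- Logarithm of the partition function divided by its expectation. -/
noncomputable def freeE (s : S → ι → ℝ) (θ : ℝ) (g : ι → ℝ) : ℝ :=
  logPart (fun τ => θ * energy s g τ) - log (Fintype.card S) - θ ^ 2 * Fintype.card ι / 2

theorem wt_nonneg (s : S → ι → ℝ) (θ : ℝ) (g : ι → ℝ) (σ : S) : 0 ≤ wt s θ g σ :=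
  gibbsWt_nonneg _ _

theorem sum_wt [Nonempty S] (s : S → ι → ℝ) (θ : ℝ) (g : ι → ℝ) : ∑ σ, wt s θ g σ = 1 :=
  sum_gibbsWt _

theorem wt_le_one [Nonempty S] (s : S → ι → ℝ) (θ : ℝ) (g : ι → ℝ) (σ : S) : wt s θ g σ ≤ 1 :=
  gibbsWt_le_one _ _

theorem sum_coeff_mul_mag (s : S → ι → ℝ) (θ : ℝ) (g : ι → ℝ) (σ : S) :
    ∑ p, s σ p * mag s θ g p = ∑ ρ, wt s θ g ρ * corr s σ ρ := by
  simp only [mag, corr, mul_sum]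
  rw [sum_comm]
  exact sum_congr rfl fun _ _ => sum_congr rfl fun _ _ => by ring

theorem sum_mag_sq (s : S → ι → ℝ) (θ : ℝ) (g : ι → ℝ) :
    ∑ p, mag s θ g p ^ 2 = ∑ σ, ∑ τ, wt s θ g σ * wt s θ g τ * corr s σ τ := by
  have : ∀ σ, ∑ τ, wt s θ g σ * wt s θ g τ * corr s σ τ = wt s θ g σ * ∑ p, s σ p * mag s θ g p := by
    intro σ
    rw [sum_coeff_mul_mag, mul_sum]
    exact sum_congr rfl fun _ _ => by ring
  simp only [this, mul_sum]
  rw [sum_comm]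
  refine sum_congr rfl fun p _ => ?_
  rw [sq]
  nth_rw 1 [mag]
  rw [sum_mul]
  exact sum_congr rfl fun _ _ => by ring

@[fun_prop]
theorem measurable_wt (s : S → ι → ℝ) (θ : ℝ) (σ : S) : Measurable fun g => wt s θ g σ := by
  unfold wt gibbsWt; fun_prop

@[fun_prop]
theorem measurable_mag (s : S → ι → ℝ) (θ : ℝ) (p : ι) : Measurable fun g => mag s θ g p := by
  unfold mag; fun_prop

@[fun_prop]
theorem measurable_freeE (s : S → ι → ℝ) (θ : ℝ) : Measurable fun g => freeE s θ g := by
  unfold freeE logPart; fun_prop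

variable [Nonempty S]

theorem hasDerivAt_wt_update [DecidableEq ι] (s : S → ι → ℝ) (θ : ℝ) (g : ι → ℝ) (p : ι) (σ : S)
    (x : ℝ) : HasDerivAt (fun y => wt s θ (Function.update g p y) σ)
      (wt s θ (Function.update g p x) σ * (θ * (s σ p - mag s θ (Function.update g p x) p))) x := by
  refine (hasDerivAt_gibbsWt (fun τ => (hasDerivAt_energy_update s g p τ x).const_mul θ)
    σ).congr_deriv ?_
  simp only [wt, mag]
  rw [mul_sub θ, mul_sum]
  congr 2
  exact sum_congr rfl fun _ _ => by ring

theorem hasDerivAt_mag_update [DecidableEq ι] {s : S → ι → ℝ} (hs : ∀ σ p, s σ p * s σ p = 1)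
    (θ : ℝ) (g : ι → ℝ) (p : ι) (x : ℝ) :
    HasDerivAt (fun y => mag s θ (Function.update g p y) p)
      (θ * (1 - mag s θ (Function.update g p x) p ^ 2)) x := by
  refine (HasDerivAt.fun_sum fun σ _ =>
    (hasDerivAt_wt_update s θ g p σ x).mul_const (s σ p)).congr_deriv ?_
  set g' := Function.update g p x
  have h : ∀ σ, wt s θ g' σ * (θ * (s σ p - mag s θ g' p)) * s σ p
      = θ * wt s θ g' σ - θ * mag s θ g' p * (wt s θ g' σ * s σ p) := fun σ => by
    linear_combination wt s θ g' σ * θ * hs σ p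
  simp only [h]
  rw [sum_sub_distrib, ← mul_sum, ← mul_sum, sum_wt, ← mag]
  ring

theorem hasDerivAt_freeE_update [DecidableEq ι] (s : S → ι → ℝ) (θ : ℝ) (g : ι → ℝ) (p : ι)
    (x : ℝ) : HasDerivAt (fun y => freeE s θ (Function.update g p y))
      (θ * mag s θ (Function.update g p x) p) x := by
  refine ((hasDerivAt_logPart (fun τ => (hasDerivAt_energy_update s g p τ x).const_mul θ)).sub_const
    (log (Fintype.card S)) |>.sub_const (θ ^ 2 * Fintype.card ι / 2)).congr_deriv ?_
  simp only [mag, wt, mul_sum]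
  exact sum_congr rfl fun _ _ => by ring

theorem hasDerivAt_freeE (s : S → ι → ℝ) (θ : ℝ) (g : ι → ℝ) :
    HasDerivAt (fun t => freeE s t g)
      (∑ p, g p * mag s θ g p - θ * Fintype.card ι) θ := by
  have h1 : HasDerivAt (fun t : ℝ => t ^ 2 * (Fintype.card ι : ℝ) / 2) (θ * Fintype.card ι) θ := by
    refine ((((hasDerivAt_id θ).pow 2).mul_const (Fintype.card ι : ℝ)).div_const 2).congr_deriv ?_
    simp
    ring
  have h2 := hasDerivAt_logPart (e := fun t τ => t * energy s g τ) (x := θ)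
    (fun τ => (hasDerivAt_id θ).mul_const (energy s g τ))
  refine ((h2.sub_const (log (Fintype.card S))).sub h1).congr_deriv ?_
  congr 1
  simp only [energy, mag, wt, mul_sum, one_mul]
  rw [sum_comm]
  exact sum_congr rfl fun _ _ => sum_congr rfl fun _ _ => by ring

theorem abs_mag_le {s : S → ι → ℝ} (hs : ∀ σ p, s σ p * s σ p = 1) (θ : ℝ) (g : ι → ℝ) (p : ι) :
    |mag s θ g p| ≤ 1 := by
  refine (abs_sum_le_sum_abs _ _).trans ?_
  simp [abs_mul, abs_coeff_eq_one hs, abs_of_nonneg (wt_nonneg s θ g _), sum_wt]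

theorem abs_freeE_le {s : S → ι → ℝ} (hs : ∀ σ p, s σ p * s σ p = 1) (θ : ℝ) (g : ι → ℝ) :
    |freeE s θ g| ≤ |θ| * ∑ p, |g p| + θ ^ 2 * Fintype.card ι / 2 := by
  have hc : (0 : ℝ) < Fintype.card S := by exact_mod_cast Fintype.card_pos
  have hb : ∀ σ, |θ * energy s g σ| ≤ |θ| * ∑ p, |g p| := fun σ => by
    rw [abs_mul]; exact mul_le_mul_of_nonneg_left (abs_energy_le hs g σ) (abs_nonneg _)
  have h1 : logPart (fun τ => θ * energy s g τ) ≤ log (Fintype.card S) + |θ| * ∑ p, |g p| := by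
    rw [← log_exp (|θ| * ∑ p, |g p|), ← log_mul hc.ne' (exp_pos _).ne']
    refine log_le_log (sum_exp_pos _) ?_
    calc _ ≤ ∑ _τ : S, exp (|θ| * ∑ p, |g p|) :=
          sum_le_sum fun σ _ => exp_le_exp.2 (abs_le.1 (hb σ)).2
      _ = _ := by simp
  have h2 : log (Fintype.card S) - |θ| * ∑ p, |g p| ≤ logPart (fun τ => θ * energy s g τ) := by
    rw [sub_eq_add_neg, ← log_exp (-(|θ| * ∑ p, |g p|)), ← log_mul hc.ne' (exp_pos _).ne']
    refine log_le_log (by positivity) ?_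
    calc _ = ∑ _τ : S, exp (-(|θ| * ∑ p, |g p|)) := by simp
      _ ≤ _ := sum_le_sum fun σ _ => exp_le_exp.2 (abs_le.1 (hb σ)).1
  have h3 : 0 ≤ θ ^ 2 * Fintype.card ι / 2 := by positivity
  rw [freeE, abs_le]
  constructor <;> linarith

end System

/-! ### Second moment of the covariance under the Gibbs measure -/

section SecondMoment

variable {ι S : Type} [Fintype ι] [Fintype S] [Nonempty S]

theorem abs_freeE_le_mul {s : S → ι → ℝ} (hs : ∀ σ p, s σ p * s σ p = 1) {t T : ℝ}
    (ht : |t| ≤ T) (g : ι → ℝ) :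
    |freeE s t g| ≤ (T + T ^ 2 * Fintype.card ι) * (1 + ∑ p, |g p|) := by
  have hn : 0 ≤ ∑ p, |g p| := sum_nonneg fun _ _ => abs_nonneg _
  have hT : 0 ≤ T := (abs_nonneg t).trans ht
  have h2 : t ^ 2 ≤ T ^ 2 := by rw [← sq_abs]; gcongr
  refine (abs_freeE_le hs t g).trans ?_
  have h3 : |t| * ∑ p, |g p| ≤ T * ∑ p, |g p| := by gcongr
  have h4 : t ^ 2 * (Fintype.card ι : ℝ) ≤ T ^ 2 * Fintype.card ι := by gcongr
  have h5 : 0 ≤ T ^ 2 * (Fintype.card ι : ℝ) := by positivity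
  nlinarith [mul_nonneg h5 hn]

theorem integrable_freeE_sq {s : S → ι → ℝ} (hs : ∀ σ p, s σ p * s σ p = 1) (t : ℝ) :
    Integrable (fun g => freeE s t g ^ 2) (gaussPi ι) := by
  refine integrable_of_quadratic_growth (by fun_prop)
    ((|t| + |t| ^ 2 * Fintype.card ι) ^ 2) fun g => ?_
  rw [abs_pow, ← mul_pow]
  exact pow_le_pow_left₀ (abs_nonneg _) (abs_freeE_le_mul hs le_rfl g) 2

theorem integrable_freeE {s : S → ι → ℝ} (hs : ∀ σ p, s σ p * s σ p = 1) (t : ℝ) :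
    Integrable (fun g => freeE s t g) (gaussPi ι) :=
  ((memLp_two_iff_integrable_sq (by fun_prop)).2 (integrable_freeE_sq hs t)).integrable (by norm_num)

theorem sum_mag_sq_le {s : S → ι → ℝ} (hs : ∀ σ p, s σ p * s σ p = 1) (θ : ℝ) (g : ι → ℝ) :
    |∑ p, mag s θ g p ^ 2| ≤ Fintype.card ι := by
  refine (abs_sum_le_sum_abs _ _).trans ?_
  calc ∑ p, |mag s θ g p ^ 2| ≤ ∑ _p : ι, (1 : ℝ) := sum_le_sum fun p _ => by
        rw [abs_pow]; exact pow_le_one₀ (abs_nonneg _) (abs_mag_le hs θ g p)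
    _ = _ := by simp

theorem integral_coord_mul_freeE_mul_mag [DecidableEq ι] {s : S → ι → ℝ}
    (hs : ∀ σ p, s σ p * s σ p = 1) (θ : ℝ) (p : ι) :
    Integrable (fun g => g p * (freeE s θ g * mag s θ g p)) (gaussPi ι) ∧
    Integrable (fun g => θ * mag s θ g p * mag s θ g p
      + freeE s θ g * (θ * (1 - mag s θ g p ^ 2))) (gaussPi ι) ∧
    ∫ g, g p * (freeE s θ g * mag s θ g p) ∂gaussPi ι
      = ∫ g, θ * mag s θ g p * mag s θ g p + freeE s θ g * (θ * (1 - mag s θ g p ^ 2))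
          ∂gaussPi ι := by
  have hm : ∀ g, |mag s θ g p| ≤ 1 := fun g => abs_mag_le hs θ g p
  have hb : ∀ g, |freeE s θ g| ≤ (|θ| + |θ| ^ 2 * Fintype.card ι) * (1 + ∑ p, |g p|) :=
    abs_freeE_le_mul hs le_rfl
  have hC : 0 ≤ |θ| + |θ| ^ 2 * (Fintype.card ι : ℝ) := by positivity
  have hi : Integrable (fun g => freeE s θ g * mag s θ g p) (gaussPi ι) :=
    (integrable_freeE hs θ).mul_bdd (c := 1) (by fun_prop) (Filter.Eventually.of_forall hm)
  have hi1 : Integrable (fun g => g p * (freeE s θ g * mag s θ g p)) (gaussPi ι) := by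
    refine integrable_of_quadratic_growth (by fun_prop) (|θ| + |θ| ^ 2 * Fintype.card ι) fun g => ?_
    have hp : |g p| ≤ 1 + ∑ p, |g p| := by
      have := single_le_sum (f := fun p => |g p|) (fun q _ => abs_nonneg (g q)) (mem_univ p)
      linarith
    rw [abs_mul, abs_mul]
    calc |g p| * (|freeE s θ g| * |mag s θ g p|)
        ≤ (1 + ∑ p, |g p|) * (((|θ| + |θ| ^ 2 * Fintype.card ι) * (1 + ∑ p, |g p|)) * 1) := by
          gcongr
          · exact hb g
          · exact hm g
      _ = _ := by ring
  have hi2 : Integrable (fun g => θ * mag s θ g p * mag s θ g p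
      + freeE s θ g * (θ * (1 - mag s θ g p ^ 2))) (gaussPi ι) := by
    refine Integrable.add ?_ ?_
    · refine Integrable.of_bound (C := |θ|) (by fun_prop) (Filter.Eventually.of_forall fun g => ?_)
      rw [norm_mul, norm_mul, Real.norm_eq_abs, Real.norm_eq_abs, mul_assoc]
      exact mul_le_of_le_one_right (abs_nonneg _)
        (mul_le_one₀ (hm g) (abs_nonneg _) (hm g))
    · refine (integrable_freeE hs θ).mul_bdd (c := |θ|) (by fun_prop)
        (Filter.Eventually.of_forall fun g => ?_)
      rw [norm_mul, Real.norm_eq_abs, Real.norm_eq_abs]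
      refine mul_le_of_le_one_right (abs_nonneg _) ?_
      have := pow_le_one₀ (n := 2) (abs_nonneg _) (hm g)
      rw [sq_abs] at this
      rw [abs_le]
      constructor <;> nlinarith [sq_nonneg (mag s θ g p)]
  exact ⟨hi1, hi2, integral_coord_mul p (fun g x => (hasDerivAt_freeE_update s θ g p x).mul
    (hasDerivAt_mag_update hs θ g p x)) hi hi1 hi2⟩

theorem hasDerivAt_integral_freeE_sq {s : S → ι → ℝ} (hs : ∀ σ p, s σ p * s σ p = 1) (θ : ℝ) :
    HasDerivAt (fun t => ∫ g, freeE s t g ^ 2 ∂gaussPi ι)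
      (2 * θ * ∫ g, (∑ p, mag s θ g p ^ 2) * (1 - freeE s θ g) ∂gaussPi ι) θ := by
  classical
  set P : ℝ := (Fintype.card ι : ℝ) with hP
  set T := |θ| + 1 with hT
  have hT0 : 0 ≤ T := by positivity
  have hmain := (hasDerivAt_integral_of_dominated_loc_of_deriv_le (μ := gaussPi ι)
    (F := fun t g => freeE s t g ^ 2) (x₀ := θ) (s := Metric.ball θ 1)
    (F' := fun t g => 2 * freeE s t g * (∑ p, g p * mag s t g p - t * P))
    (bound := fun g => 2 * (T + T ^ 2 * P) * (1 + T * P) * (1 + ∑ p, |g p|) ^ 2)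
    (Metric.ball_mem_nhds θ one_pos) (Filter.Eventually.of_forall fun t => by fun_prop)
    (integrable_freeE_sq hs θ) (by fun_prop)
    (Filter.Eventually.of_forall fun g t ht => ?_) ?_
    (Filter.Eventually.of_forall fun g t _ => ?_)).2
  · refine hmain.congr_deriv ?_
    have h1 : ∀ g, 2 * freeE s θ g * (∑ p, g p * mag s θ g p - θ * P)
        = 2 * ∑ p, g p * (freeE s θ g * mag s θ g p) - 2 * θ * P * freeE s θ g := fun g => by
      rw [mul_sub, mul_sum, mul_sum]
      congr 1
      · exact sum_congr rfl fun _ _ => by ring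
      · ring
    simp only [h1]
    have hL := integrable_freeE hs θ
    have hG : Integrable (fun g => (∑ p, mag s θ g p ^ 2)) (gaussPi ι) :=
      Integrable.of_bound (C := P) (by fun_prop)
        (Filter.Eventually.of_forall fun g => sum_mag_sq_le hs θ g)
    have hGL : Integrable (fun g => freeE s θ g * (∑ p, mag s θ g p ^ 2)) (gaussPi ι) :=
      hL.mul_bdd (c := P) (by fun_prop) (Filter.Eventually.of_forall fun g => sum_mag_sq_le hs θ g)
    have hsum : ∫ g, ∑ p, g p * (freeE s θ g * mag s θ g p) ∂gaussPi ι
        = ∫ g, θ * (∑ p, mag s θ g p ^ 2)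
            + (θ * P * freeE s θ g - θ * (freeE s θ g * ∑ p, mag s θ g p ^ 2)) ∂gaussPi ι := by
      rw [integral_finsetSum _ fun p _ => (integral_coord_mul_freeE_mul_mag hs θ p).1]
      simp only [(integral_coord_mul_freeE_mul_mag hs θ _).2.2]
      rw [← integral_finsetSum]
      · refine integral_congr_ae (Filter.Eventually.of_forall fun g => ?_)
        simp only
        rw [sum_add_distrib, ← mul_sum, ← mul_sum, sum_sub_distrib, mul_sum]
        simp only [sum_const, card_univ, nsmul_eq_mul, mul_one, ← hP]
        have : ∑ p, θ * mag s θ g p * mag s θ g p = ∑ p, θ * mag s θ g p ^ 2 :=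
          sum_congr rfl fun _ _ => by ring
        rw [this]; ring
      · exact fun p _ => (integral_coord_mul_freeE_mul_mag hs θ p).2.1
    have hsub : Integrable (fun g => θ * P * freeE s θ g
        - θ * (freeE s θ g * ∑ p, mag s θ g p ^ 2)) (gaussPi ι) :=
      (hL.const_mul _).sub (hGL.const_mul _)
    rw [integral_sub ((integrable_finsetSum _ fun p _ =>
      (integral_coord_mul_freeE_mul_mag hs θ p).1).const_mul 2) (hL.const_mul _),
      integral_const_mul, hsum, integral_const_mul,
      integral_add (hG.const_mul _) hsub,
      integral_sub (hL.const_mul _) (hGL.const_mul _), integral_const_mul, integral_const_mul,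
      integral_const_mul]
    have h2 : ∀ g, (∑ p, mag s θ g p ^ 2) * (1 - freeE s θ g)
        = (∑ p, mag s θ g p ^ 2) - freeE s θ g * ∑ p, mag s θ g p ^ 2 := fun g => by ring
    simp only [h2]
    rw [integral_sub hG hGL]
    ring
  · have htT : |t| ≤ T := by
      rw [Metric.mem_ball, Real.dist_eq] at ht
      calc |t| = |θ + (t - θ)| := by ring_nf
        _ ≤ |θ| + |t - θ| := abs_add_le _ _
        _ ≤ T := by linarith
    have hn : 0 ≤ ∑ p, |g p| := sum_nonneg fun _ _ => abs_nonneg _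
    have hP0 : 0 ≤ P := Nat.cast_nonneg _
    have hb := abs_freeE_le_mul hs htT g
    have hd : |∑ p, g p * mag s t g p - t * P| ≤ (1 + T * P) * (1 + ∑ p, |g p|) := by
      have h1 : |∑ p, g p * mag s t g p| ≤ ∑ p, |g p| :=
        (abs_sum_le_sum_abs _ _).trans <| sum_le_sum fun p _ => by
          rw [abs_mul]; exact mul_le_of_le_one_right (abs_nonneg _) (abs_mag_le hs t g p)
      have h2 : |t * P| ≤ T * P := by
        rw [abs_mul, abs_of_nonneg hP0]; gcongr
      refine (abs_sub _ _).trans ?_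
      nlinarith [mul_nonneg (mul_nonneg hT0 hP0) hn]
    rw [Real.norm_eq_abs, abs_mul, abs_mul, abs_two]
    calc 2 * |freeE s t g| * |∑ p, g p * mag s t g p - t * P|
        ≤ 2 * ((T + T ^ 2 * P) * (1 + ∑ p, |g p|)) * ((1 + T * P) * (1 + ∑ p, |g p|)) := by
          gcongr
      _ = _ := by ring
  · refine integrable_of_quadratic_growth (by fun_prop)
      (2 * (T + T ^ 2 * P) * (1 + T * P)) fun g => ?_
    rw [abs_of_nonneg]
    have hP0 : 0 ≤ P := Nat.cast_nonneg _
    positivity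
  · refine ((hasDerivAt_freeE s t g).pow 2).congr_deriv ?_
    simp [hP]

/-- Normalized two-replica partition function with a coupling of strength `κ`. -/
noncomputable def coupledPart (s : S → ι → ℝ) (κ θ : ℝ) (g : ι → ℝ) : ℝ :=
  (∑ z : S × S, exp (θ * (energy s g z.1 + energy s g z.2) + κ * corr s z.1 z.2))
    / (Fintype.card S ^ 2 * exp (θ ^ 2 * Fintype.card ι))

theorem coupledPart_pos (s : S → ι → ℝ) (κ θ : ℝ) (g : ι → ℝ) : 0 < coupledPart s κ θ g := by
  have hc : (0 : ℝ) < Fintype.card S := by exact_mod_cast Fintype.card_pos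
  exact div_pos (sum_exp_pos _) (by positivity)

theorem log_sum_wt_mul_wt_mul_exp (s : S → ι → ℝ) (κ θ : ℝ) (g : ι → ℝ) :
    log (∑ z : S × S, wt s θ g z.1 * wt s θ g z.2 * exp (κ * corr s z.1 z.2))
      = log (coupledPart s κ θ g) - 2 * freeE s θ g := by
  have hc : (0 : ℝ) < Fintype.card S := by exact_mod_cast Fintype.card_pos
  set Z := ∑ τ, exp (θ * energy s g τ) with hZ
  have hZpos : 0 < Z := sum_exp_pos _
  have h1 : ∑ z : S × S, wt s θ g z.1 * wt s θ g z.2 * exp (κ * corr s z.1 z.2)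
      = (∑ z : S × S, exp (θ * (energy s g z.1 + energy s g z.2) + κ * corr s z.1 z.2))
        / Z ^ 2 := by
    rw [sum_div]
    refine sum_congr rfl fun z _ => ?_
    rw [mul_add, exp_add, exp_add]
    simp only [wt, gibbsWt, ← hZ]
    field_simp
  have hD := sum_exp_pos
    (fun z : S × S => θ * (energy s g z.1 + energy s g z.2) + κ * corr s z.1 z.2)
  rw [h1, coupledPart, log_div hD.ne' (by positivity), log_div hD.ne' (by positivity),
    log_mul (by positivity) (exp_pos _).ne', log_exp, log_pow, log_pow, freeE, logPart, ← hZ]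
  push_cast
  ring

theorem integral_coupledPart {s : S → ι → ℝ} (hs : ∀ σ p, s σ p * s σ p = 1) (κ θ : ℝ) :
    Integrable (coupledPart s κ θ) (gaussPi ι) ∧
    ∫ g, coupledPart s κ θ g ∂gaussPi ι
      = (∑ σ, ∑ τ, exp ((θ ^ 2 + κ) * corr s σ τ)) / Fintype.card S ^ 2 := by
  have hc : (0 : ℝ) < Fintype.card S := by exact_mod_cast Fintype.card_pos
  have he : ∀ (g : ι → ℝ) (z : S × S),
      exp (θ * (energy s g z.1 + energy s g z.2) + κ * corr s z.1 z.2)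
        = exp (∑ p, g p * (θ * (s z.1 p + s z.2 p))) * exp (κ * corr s z.1 z.2) := by
    intro g z
    rw [exp_add]
    congr 2
    rw [energy, energy, ← sum_add_distrib, mul_sum]
    exact sum_congr rfl fun _ _ => by ring
  have hi : ∀ z : S × S, Integrable (fun g : ι → ℝ =>
      exp (∑ p, g p * (θ * (s z.1 p + s z.2 p))) * exp (κ * corr s z.1 z.2)) (gaussPi ι) :=
    fun z => (integrable_exp_linear _).mul_const _
  have hv : ∀ z : S × S, ∫ g : ι → ℝ, exp (∑ p, g p * (θ * (s z.1 p + s z.2 p)))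
      * exp (κ * corr s z.1 z.2) ∂gaussPi ι
      = exp ((θ ^ 2 + κ) * corr s z.1 z.2) * exp (θ ^ 2 * Fintype.card ι) := by
    intro z
    rw [integral_mul_const, integral_exp_linear, ← exp_add, ← exp_add]
    congr 1
    have : ∑ p, (θ * (s z.1 p + s z.2 p)) ^ 2
        = 2 * θ ^ 2 * (Fintype.card ι + corr s z.1 z.2) := by
      have h1 : (Fintype.card ι : ℝ) = ∑ _p : ι, (1 : ℝ) := by simp
      rw [corr, h1, ← sum_add_distrib, mul_sum]
      refine sum_congr rfl fun p _ => ?_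
      linear_combination θ ^ 2 * (hs z.1 p + hs z.2 p)
    rw [this]; ring
  unfold coupledPart
  simp only [he]
  refine ⟨(integrable_finsetSum _ fun z _ => hi z).div_const _, ?_⟩
  rw [integral_div, integral_finsetSum _ fun z _ => hi z]
  simp only [hv]
  rw [← sum_mul, Fintype.sum_prod_type]
  field_simp

theorem max_log_zero_sq_le {x : ℝ} (hx : 0 < x) : max (log x) 0 ^ 2 ≤ 4 * x := by
  rcases le_total (log x) 0 with h | h
  · rw [max_eq_right h]; nlinarith
  · rw [max_eq_left h]
    have h1 : log √x ≤ √x - 1 := log_le_sub_one_of_pos (sqrt_pos.2 hx)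
    rw [log_sqrt hx.le] at h1
    nlinarith [sq_sqrt hx.le, sqrt_nonneg x]

/-- The logarithmic exponential moment of the covariance, and its size. -/
theorem log_moment_bounds (s : S → ι → ℝ) {κ : ℝ} (hκ : 0 ≤ κ) (θ : ℝ) (g : ι → ℝ) :
    κ * ∑ p, mag s θ g p ^ 2
        ≤ log (∑ z : S × S, wt s θ g z.1 * wt s θ g z.2 * exp (κ * corr s z.1 z.2)) ∧
    0 ≤ log (∑ z : S × S, wt s θ g z.1 * wt s θ g z.2 * exp (κ * corr s z.1 z.2)) ∧
    log (∑ z : S × S, wt s θ g z.1 * wt s θ g z.2 * exp (κ * corr s z.1 z.2))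
        ≤ max (log (coupledPart s κ θ g)) 0 + 2 * |freeE s θ g| := by
  have hw : ∀ z : S × S, 0 ≤ wt s θ g z.1 * wt s θ g z.2 := fun z =>
    mul_nonneg (wt_nonneg ..) (wt_nonneg ..)
  have h1 : ∑ z : S × S, wt s θ g z.1 * wt s θ g z.2 = 1 := by
    simp [Fintype.sum_prod_type, ← mul_sum, sum_wt]
  have hj := exp_sum_mul_le (X := fun z : S × S => κ * corr s z.1 z.2) hw h1
  have ha : ∑ z : S × S, wt s θ g z.1 * wt s θ g z.2 * (κ * corr s z.1 z.2)
      = κ * ∑ p, mag s θ g p ^ 2 := by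
    rw [sum_mag_sq, Fintype.sum_prod_type, mul_sum]
    refine sum_congr rfl fun _ _ => ?_
    rw [mul_sum]
    exact sum_congr rfl fun _ _ => by ring
  rw [ha] at hj
  have hfst : κ * ∑ p, mag s θ g p ^ 2
      ≤ log (∑ z : S × S, wt s θ g z.1 * wt s θ g z.2 * exp (κ * corr s z.1 z.2)) := by
    rw [← log_exp (κ * ∑ p, mag s θ g p ^ 2)]
    exact log_le_log (exp_pos _) hj
  refine ⟨hfst, le_trans (by positivity) hfst, ?_⟩
  rw [log_sum_wt_mul_wt_mul_exp]
  have := le_max_left (log (coupledPart s κ θ g)) 0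
  have := neg_abs_le (freeE s θ g)
  linarith

/-- Uniform second-moment bound on the normalized free energy. -/
theorem integral_freeE_sq_le {s : S → ι → ℝ} (hs : ∀ σ p, s σ p * s σ p = 1) {κ θ K : ℝ}
    (hκ : 0 < κ) (hθ : 0 ≤ θ) (hK0 : 0 ≤ K)
    (hK : ∀ t, 0 ≤ t → t ≤ θ →
      ∑ σ, ∑ τ, exp ((t ^ 2 + κ) * corr s σ τ) ≤ K * Fintype.card S ^ 2) :
    ∫ g, freeE s θ g ^ 2 ∂gaussPi ι ≤ (K + 1) * exp (4 * θ ^ 2 / κ) := by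
  have hc : (0 : ℝ) < Fintype.card S := by exact_mod_cast Fintype.card_pos
  set Y : ℝ → ℝ := fun t => ∫ g, freeE s t g ^ 2 ∂gaussPi ι with hY
  set Y' : ℝ → ℝ := fun t =>
    2 * t * ∫ g, (∑ p, mag s t g p ^ 2) * (1 - freeE s t g) ∂gaussPi ι with hY'
  have hder : ∀ t, HasDerivAt Y (Y' t) t := hasDerivAt_integral_freeE_sq hs
  have hint : ∀ t, 0 ≤ t → t ≤ θ →
      κ * ∫ g, (∑ p, mag s t g p ^ 2) * (1 - freeE s t g) ∂gaussPi ι ≤ 4 * (K + 1 + Y t) := by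
    intro t h0 h1
    obtain ⟨hWi, hW⟩ := integral_coupledPart hs κ t
    have hWK : ∫ g, coupledPart s κ t g ∂gaussPi ι ≤ K := by
      rw [hW, div_le_iff₀ (by positivity)]; exact hK t h0 h1
    have hb : ∫ g, κ * ((∑ p, mag s t g p ^ 2) * (1 - freeE s t g)) ∂gaussPi ι
        ≤ ∫ g, (4 * coupledPart s κ t g + (4 * freeE s t g ^ 2 + 2)) ∂gaussPi ι := by
      have hGi : Integrable (fun g => (∑ p, mag s t g p ^ 2) * (1 - freeE s t g)) (gaussPi ι) :=
        ((integrable_const 1).sub (integrable_freeE hs t)).bdd_mul (c := Fintype.card ι)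
          (by fun_prop) (Filter.Eventually.of_forall fun g => sum_mag_sq_le hs t g)
      refine integral_mono (hGi.const_mul κ) ((hWi.const_mul 4).add
        (((integrable_freeE_sq hs t).const_mul 4).add (integrable_const 2))) fun g => ?_
      obtain ⟨h2, h3, h4⟩ := log_moment_bounds s hκ.le t g
      have hA := max_log_zero_sq_le (coupledPart_pos s κ t g)
      have hA0 := le_max_right (log (coupledPart s κ t g)) 0
      simp only
      set ψ := log (∑ z : S × S, wt s t g z.1 * wt s t g z.2 * exp (κ * corr s z.1 z.2))
      set A := max (log (coupledPart s κ t g)) 0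
      have hG0 : 0 ≤ κ * ∑ p, mag s t g p ^ 2 := by positivity
      have hL := neg_abs_le (freeE s t g)
      have hL0 := abs_nonneg (freeE s t g)
      have h5 : κ * ((∑ p, mag s t g p ^ 2) * (1 - freeE s t g))
          ≤ (A + 2 * |freeE s t g|) * (1 + |freeE s t g|) := by
        rw [← mul_assoc]
        calc _ ≤ (κ * ∑ p, mag s t g p ^ 2) * (1 + |freeE s t g|) :=
              mul_le_mul_of_nonneg_left (by linarith) hG0
          _ ≤ _ := mul_le_mul_of_nonneg_right (h2.trans h4) (by linarith)
      have h6 := sq_abs (freeE s t g)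
      nlinarith [sq_nonneg (A - 1), sq_nonneg (A - |freeE s t g|), sq_nonneg (|freeE s t g| - 1)]
    rw [integral_const_mul] at hb
    refine hb.trans ?_
    have hsq := integrable_freeE_sq hs t
    have hsq' : Integrable (fun g => 4 * freeE s t g ^ 2 + 2) (gaussPi ι) :=
      (hsq.const_mul 4).add (integrable_const 2)
    rw [integral_add (hWi.const_mul 4) hsq', integral_add (hsq.const_mul 4) (integrable_const 2),
      integral_const_mul, integral_const_mul]
    simp only [integral_const, probReal_univ, one_smul, hY]
    linarith
  set Φ : ℝ → ℝ := fun t => (Y t + (K + 1)) * exp (-(4 * t ^ 2 / κ)) with hΦ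
  have hΦd : ∀ t, HasDerivAt Φ
      (Y' t * exp (-(4 * t ^ 2 / κ))
        + (Y t + (K + 1)) * (exp (-(4 * t ^ 2 / κ)) * (-(8 * t / κ)))) t := by
    intro t
    have he : HasDerivAt (fun t : ℝ => -(4 * t ^ 2 / κ)) (-(8 * t / κ)) t := by
      refine ((((hasDerivAt_id t).pow 2).const_mul 4).div_const κ).neg.congr_deriv ?_
      simp; ring
    exact ((hder t).add_const (K + 1)).mul he.exp
  have hanti : AntitoneOn Φ (Set.Icc 0 θ) := by
    refine antitoneOn_of_deriv_nonpos (convex_Icc 0 θ)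
      (fun t _ => (hΦd t).continuousAt.continuousWithinAt)
      (fun t _ => (hΦd t).differentiableAt.differentiableWithinAt) fun t ht => ?_
    rw [interior_Icc] at ht
    rw [(hΦd t).deriv]
    have h1 := hint t ht.1.le ht.2.le
    have h2 : Y' t ≤ (Y t + (K + 1)) * (8 * t / κ) := by
      simp only [hY']
      rw [mul_div_assoc', le_div_iff₀ hκ]
      nlinarith [ht.1]
    have := mul_le_mul_of_nonneg_right h2 (exp_pos (-(4 * t ^ 2 / κ))).le
    linarith
  have h0 : Y 0 = 0 := by
    have : ∀ g : ι → ℝ, freeE s 0 g = 0 := fun g => by simp [freeE, logPart]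
    simp [hY, this]
  have hfin := hanti (Set.left_mem_Icc.2 hθ) (Set.right_mem_Icc.2 hθ) hθ
  simp only [hΦ, h0] at hfin
  simp only [ne_eq, OfNat.ofNat_ne_zero, not_false_eq_true, zero_pow, mul_zero, zero_div, neg_zero,
    exp_zero, mul_one, zero_add] at hfin
  rw [exp_neg, ← div_eq_mul_inv, div_le_iff₀ (exp_pos _)] at hfin
  linarith

/-- Second moment of the covariance of two replicas under the quenched Gibbs measure. -/
theorem integral_corr_sq_le {s : S → ι → ℝ} (hs : ∀ σ p, s σ p * s σ p = 1) {κ θ K : ℝ}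
    (hκ : 0 < κ) (hθ : 0 ≤ θ) (hK0 : 0 ≤ K) (hlow : ∀ σ τ, -1 ≤ κ * corr s σ τ)
    (hK : ∀ t, 0 ≤ t → t ≤ θ →
      ∑ σ, ∑ τ, exp ((t ^ 2 + κ) * corr s σ τ) ≤ K * Fintype.card S ^ 2) :
    ∫ g, ∑ σ, ∑ τ, wt s θ g σ * wt s θ g τ * corr s σ τ ^ 2 ∂gaussPi ι
      ≤ 9 / κ ^ 2 * (1 + 4 * K + 4 * ((K + 1) * exp (4 * θ ^ 2 / κ))) := by
  have hc : (0 : ℝ) < Fintype.card S := by exact_mod_cast Fintype.card_pos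
  obtain ⟨hWi, hW⟩ := integral_coupledPart hs κ θ
  have hWK : ∫ g, coupledPart s κ θ g ∂gaussPi ι ≤ K := by
    rw [hW, div_le_iff₀ (by positivity)]; exact hK θ hθ le_rfl
  have hsq := integrable_freeE_sq hs θ
  have hpt : ∀ g, ∑ σ, ∑ τ, wt s θ g σ * wt s θ g τ * corr s σ τ ^ 2
      ≤ 9 / κ ^ 2 * (1 + 4 * coupledPart s κ θ g + 4 * freeE s θ g ^ 2) := by
    intro g
    have hw : ∀ z : S × S, 0 ≤ wt s θ g z.1 * wt s θ g z.2 := fun z =>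
      mul_nonneg (wt_nonneg ..) (wt_nonneg ..)
    have h1 : ∑ z : S × S, wt s θ g z.1 * wt s θ g z.2 = 1 := by
      simp [Fintype.sum_prod_type, ← mul_sum, sum_wt]
    obtain ⟨-, hψ0, hψ⟩ := log_moment_bounds s hκ.le θ g
    have hm := sum_mul_sq_le_of_log_moment (X := fun z : S × S => κ * corr s z.1 z.2) hw h1
      (fun z => hlow z.1 z.2) hψ0
    set ψ := log (∑ z : S × S, wt s θ g z.1 * wt s θ g z.2 * exp (κ * corr s z.1 z.2))
    have hA := max_log_zero_sq_le (coupledPart_pos s κ θ g)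
    have hA0 := le_max_right (log (coupledPart s κ θ g)) 0
    set A := max (log (coupledPart s κ θ g)) 0
    have hsum : ∑ z : S × S, wt s θ g z.1 * wt s θ g z.2 * (κ * corr s z.1 z.2) ^ 2
        = κ ^ 2 * ∑ σ, ∑ τ, wt s θ g σ * wt s θ g τ * corr s σ τ ^ 2 := by
      rw [Fintype.sum_prod_type, mul_sum]
      refine sum_congr rfl fun _ _ => ?_
      rw [mul_sum]
      exact sum_congr rfl fun _ _ => by ring
    rw [hsum] at hm
    have h2 : (1 + ψ) ^ 2 ≤ (1 + A + 2 * |freeE s θ g|) ^ 2 :=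
      pow_le_pow_left₀ (by linarith) (by linarith) 2
    have h3 := sq_abs (freeE s θ g)
    have h4 : (1 + A + 2 * |freeE s θ g|) ^ 2 ≤ 3 * (1 + A ^ 2 + 4 * |freeE s θ g| ^ 2) := by
      nlinarith [sq_nonneg (1 - A), sq_nonneg (1 - 2 * |freeE s θ g|),
        sq_nonneg (A - 2 * |freeE s θ g|)]
    rw [div_mul_eq_mul_div, le_div_iff₀ (by positivity)]
    nlinarith
  have hi1 : Integrable (fun g => 1 + 4 * coupledPart s κ θ g) (gaussPi ι) :=
    (integrable_const 1).add (hWi.const_mul 4)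
  have hi : Integrable (fun g => 9 / κ ^ 2 * (1 + 4 * coupledPart s κ θ g + 4 * freeE s θ g ^ 2))
      (gaussPi ι) := (hi1.add (hsq.const_mul 4)).const_mul _
  refine (integral_mono_of_nonneg (Filter.Eventually.of_forall fun g => ?_) hi
    (Filter.Eventually.of_forall hpt)).trans ?_
  · exact sum_nonneg fun _ _ => sum_nonneg fun _ _ =>
      mul_nonneg (mul_nonneg (wt_nonneg ..) (wt_nonneg ..)) (sq_nonneg _)
  rw [integral_const_mul, integral_add hi1 (hsq.const_mul 4),
    integral_add (integrable_const 1) (hWi.const_mul 4), integral_const_mul, integral_const_mul]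
  simp only [integral_const, probReal_univ, one_smul]
  have hY := integral_freeE_sq_le hs hκ hθ hK0 hK
  gcongr

end SecondMoment

/-! ### Covariances of the SK model -/

/-- Coefficients of the SK Hamiltonian. -/
def skCoeff (N : ℕ) (σ : Config N) (p : Pairs N) : ℝ := spin (σ p.1.1) * spin (σ p.1.2)

theorem spin_mul_self (b : Bool) : spin b * spin b = 1 := by cases b <;> simp [spin]

theorem skCoeff_mul_self (N : ℕ) (σ : Config N) (p : Pairs N) :
    skCoeff N σ p * skCoeff N σ p = 1 := by
  rw [skCoeff, mul_mul_mul_comm, spin_mul_self, spin_mul_self, one_mul]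

theorem two_mul_sum_pairs {N : ℕ} (f : Fin N → ℝ) :
    2 * ∑ p : Pairs N, f p.1.1 * f p.1.2 = (∑ i, f i) ^ 2 - ∑ i, f i ^ 2 := by
  have h1 : ∑ p : Pairs N, f p.1.1 * f p.1.2
      = ∑ z : Fin N × Fin N, if z.1 < z.2 then f z.1 * f z.2 else 0 := by
    rw [← sum_filter, sum_subtype (p := fun z : Fin N × Fin N => z.1 < z.2) (univ.filter _)
      (by simp) (fun z => f z.1 * f z.2)]
  have h2 : ∑ p : Pairs N, f p.1.1 * f p.1.2
      = ∑ z : Fin N × Fin N, if z.2 < z.1 then f z.1 * f z.2 else 0 := by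
    rw [h1, ← (Equiv.prodComm (Fin N) (Fin N)).sum_comp]
    simp [mul_comm]
  have h3 : ∑ i, f i ^ 2 = ∑ z : Fin N × Fin N, if z.1 = z.2 then f z.1 * f z.2 else 0 := by
    simp [Fintype.sum_prod_type, sq]
  have h4 : (∑ i, f i) ^ 2 = ∑ z : Fin N × Fin N, f z.1 * f z.2 := by
    rw [sq, sum_mul_sum, Fintype.sum_prod_type]
  rw [two_mul]
  nth_rw 1 [h1]
  rw [h2, h3, h4, ← sum_add_distrib, ← sum_sub_distrib]
  refine sum_congr rfl fun z _ => ?_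
  rcases lt_trichotomy z.1 z.2 with h | h | h
  · simp [h, h.ne, h.not_gt]
  · simp [h]
  · simp [h, h.ne', h.not_gt]

theorem two_mul_corr_skCoeff {N : ℕ} (σ τ : Config N) :
    2 * corr (skCoeff N) σ τ = (∑ i, spin (σ i) * spin (τ i)) ^ 2 - N := by
  have h := two_mul_sum_pairs fun i => spin (σ i) * spin (τ i)
  have h1 : ∀ i, (spin (σ i) * spin (τ i)) ^ 2 = 1 := fun i => by
    rw [sq, mul_mul_mul_comm, spin_mul_self, spin_mul_self, one_mul]
  simp only [h1, sum_const, card_univ, Fintype.card_fin, nsmul_eq_mul, mul_one] at h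
  rw [← h, corr]
  simp only [skCoeff]
  congr 1
  exact sum_congr rfl fun _ _ => by ring

theorem two_mul_card_pairs (N : ℕ) : 2 * (Fintype.card (Pairs N) : ℝ) = N ^ 2 - N := by
  simpa using two_mul_sum_pairs fun _ : Fin N => (1 : ℝ)

theorem integrable_exp_sq {a : ℝ} (ha : a < 1) :
    Integrable (fun z : ℝ => exp (a * z ^ 2 / 2)) (gaussianReal 0 1) ∧
      ∫ z, exp (a * z ^ 2 / 2) ∂gaussianReal 0 1 = 1 / √(1 - a) := by
  have h1 : 0 < 1 - a := by linarith
  have h : ∀ z : ℝ, exp (a * z ^ 2 / 2) * gaussianPDFReal 0 1 z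
      = (√(2 * π))⁻¹ * exp (-((1 - a) / 2) * z ^ 2) := fun z => by
    rw [gaussianPDFReal, mul_left_comm, ← exp_add]
    simp only [NNReal.coe_one, mul_one, sub_zero]
    congr 2
    ring
  constructor
  · rw [integrable_gaussianReal_iff]
    simp only [h]
    exact (integrable_exp_neg_mul_sq (by positivity)).const_mul _
  · rw [integral_gaussianReal_eq_integral_smul one_ne_zero]
    simp only [smul_eq_mul, mul_comm (gaussianPDFReal 0 1 _), h]
    rw [integral_const_mul, integral_gaussian, ← sqrt_inv, ← sqrt_mul (by positivity), one_div,
      ← sqrt_inv]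
    congr 1
    field_simp

theorem sum_config_exp_le {N : ℕ} (σ : Config N) (y : ℝ) :
    ∑ τ : Config N, exp (y * ∑ i, spin (σ i) * spin (τ i)) ≤ 2 ^ N * exp (N * y ^ 2 / 2) := by
  have h1 : ∀ τ : Config N, exp (y * ∑ i, spin (σ i) * spin (τ i))
      = ∏ i, exp (y * (spin (σ i) * spin (τ i))) := fun τ => by rw [mul_sum, exp_sum]
  have h2 : ∀ b, ∑ c : Bool, exp (y * (spin b * spin c)) = 2 * cosh y := fun b => by
    cases b <;> simp [spin, cosh_eq] <;> ring
  simp only [h1]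
  rw [← Fintype.prod_sum fun i c => exp (y * (spin (σ i) * spin c))]
  simp only [h2, prod_const, card_univ, Fintype.card_fin]
  calc (2 * cosh y) ^ N ≤ (2 * exp (y ^ 2 / 2)) ^ N := by
        have := one_le_cosh y
        gcongr
        exact cosh_le_exp_half_sq y
    _ = _ := by rw [mul_pow, ← exp_nat_mul, mul_div_assoc]

theorem sum_exp_overlap_sq_le {N : ℕ} (hN : 0 < N) {a : ℝ} (ha0 : 0 ≤ a) (ha : a < 1)
    (σ : Config N) :
    ∑ τ : Config N, exp (a / N * (∑ i, spin (σ i) * spin (τ i)) ^ 2 / 2)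
      ≤ 2 ^ N * (1 / √(1 - a)) := by
  have hN' : (0 : ℝ) < N := by exact_mod_cast hN
  set ρ := √(a / N)
  have hρ : ρ ^ 2 = a / N := sq_sqrt (by positivity)
  have hint : ∀ x : ℝ, Integrable (fun z => exp (x * z)) (gaussianReal 0 1) :=
    fun x => integrable_exp_mul_gaussianReal x
  have h1 : ∀ x : ℝ, exp (a / N * x ^ 2 / 2) = ∫ z, exp (ρ * x * z) ∂gaussianReal 0 1 := by
    intro x
    have := congrFun (mgf_id_gaussianReal (μ := 0) (v := 1)) (ρ * x)
    simp only [mgf, id] at this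
    rw [this, ← hρ]
    simp [mul_pow]
  simp only [h1]
  rw [← integral_finsetSum _ fun τ _ => hint _, ← (integrable_exp_sq ha).2, ← integral_const_mul]
  refine integral_mono (integrable_finsetSum _ fun τ _ => hint _)
    ((integrable_exp_sq ha).1.const_mul _) fun z => ?_
  refine (le_of_eq (sum_congr rfl fun τ _ => ?_)).trans
    ((sum_config_exp_le σ (ρ * z)).trans (le_of_eq ?_))
  · congr 1; ring
  · rw [mul_pow, hρ]
    congr 3
    field_simp

/-- In the whole high temperature region the overlap of two replicas has a second moment of
order `1 / N`. -/
theorem exists_integral_corr_sq_le {β : ℝ} (hβ0 : 0 < β) (hβ1 : β < 1) :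
    ∃ K : ℝ, 0 < K ∧ ∀ N : ℕ, 2 ≤ N →
      ∫ g, ∑ σ, ∑ τ, wt (skCoeff N) (β / √N) g σ * wt (skCoeff N) (β / √N) g τ
        * corr (skCoeff N) σ τ ^ 2 ∂gaussPi (Pairs N) ≤ K * N ^ 2 := by
  have hβ2 : β ^ 2 < 1 := by nlinarith
  set l := (1 - β ^ 2) / 2 with hl
  have hl0 : 0 < l := by rw [hl]; linarith
  set a := l + β ^ 2
  have ha : a < 1 := by rw [show a = l + β ^ 2 from rfl, hl]; linarith
  have ha0 : 0 ≤ a := by positivity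
  have hsq : 0 < √(1 - a) := sqrt_pos.2 (by linarith)
  refine ⟨9 / l ^ 2 * (1 + 4 * (1 / √(1 - a)) + 4 * ((1 / √(1 - a) + 1) *
    exp (4 * β ^ 2 / l))), by positivity, fun N hN => ?_⟩
  have hN0 : 0 < N := by omega
  have hN' : (0 : ℝ) < N := by exact_mod_cast hN0
  have hlow : ∀ σ τ, -1 ≤ l / N * corr (skCoeff N) σ τ := fun σ τ => by
    have h := two_mul_corr_skCoeff σ τ
    have h1 : -(N : ℝ) ≤ 2 * corr (skCoeff N) σ τ := by
      rw [h]; nlinarith [sq_nonneg (∑ i, spin (σ i) * spin (τ i))]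
    rw [div_mul_eq_mul_div, le_div_iff₀ hN']
    nlinarith
  have hθ2 : (β / √N) ^ 2 = β ^ 2 / N := by rw [div_pow, sq_sqrt hN'.le]
  have hK : ∀ t, 0 ≤ t → t ≤ β / √N →
      ∑ σ, ∑ τ, exp ((t ^ 2 + l / N) * corr (skCoeff N) σ τ)
        ≤ 1 / √(1 - a) * Fintype.card (Config N) ^ 2 := by
    intro t ht0 ht
    have ht2 : t ^ 2 + l / N ≤ a / N := by
      have := pow_le_pow_left₀ ht0 ht 2
      rw [hθ2] at this
      calc _ ≤ β ^ 2 / N + l / N := by linarith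
        _ = _ := by rw [← add_div, add_comm]
    have hb0 : 0 ≤ t ^ 2 + l / N := by positivity
    have hcard : (Fintype.card (Config N) : ℝ) = 2 ^ N := by simp
    calc _ ≤ ∑ _σ : Config N, 2 ^ N * (1 / √(1 - a)) := by
          refine sum_le_sum fun σ _ => (sum_le_sum fun τ _ => ?_).trans
            (sum_exp_overlap_sq_le hN0 ha0 ha σ)
          refine exp_le_exp.2 ?_
          have h := two_mul_corr_skCoeff σ τ
          have h1 := mul_le_mul_of_nonneg_right ht2 (sq_nonneg (∑ i, spin (σ i) * spin (τ i)))
          have h2 := mul_nonneg hb0 hN'.le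
          nlinarith
      _ = _ := by
          rw [sum_const, card_univ, nsmul_eq_mul, hcard]; ring
  refine (integral_corr_sq_le (skCoeff_mul_self N) (div_pos hl0 hN') (by positivity)
    (by positivity) hlow hK).trans (le_of_eq ?_)
  rw [hθ2]
  field_simp

/-! ### Integration by parts for two replicas -/

section Growth

variable {ι : Type} [Fintype ι]

/-- Measurable functions growing at most like the `k`-th power of the `ℓ¹` norm. -/
def HasGrowth (k : ℕ) (F : (ι → ℝ) → ℝ) : Prop :=
  Measurable F ∧ ∃ C, 0 ≤ C ∧ ∀ g, |F g| ≤ C * (1 + ∑ p, |g p|) ^ k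

theorem one_le_one_add_sum_abs (g : ι → ℝ) : 1 ≤ 1 + ∑ p, |g p| :=
  le_add_of_nonneg_right (sum_nonneg fun _ _ => abs_nonneg _)

theorem HasGrowth.integrable {F : (ι → ℝ) → ℝ} (h : HasGrowth 2 F) : Integrable F (gaussPi ι) :=
  let ⟨hm, C, _, hC⟩ := h
  integrable_of_quadratic_growth hm C hC

theorem HasGrowth.mono {k l : ℕ} (hkl : k ≤ l) {F : (ι → ℝ) → ℝ} (h : HasGrowth k F) :
    HasGrowth l F :=
  let ⟨hm, C, hC0, hC⟩ := h
  ⟨hm, C, hC0, fun g => (hC g).trans (mul_le_mul_of_nonneg_left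
    (pow_le_pow_right₀ (one_le_one_add_sum_abs g) hkl) hC0)⟩

theorem HasGrowth.mul {k l : ℕ} {F G : (ι → ℝ) → ℝ} (hF : HasGrowth k F) (hG : HasGrowth l G) :
    HasGrowth (k + l) fun g => F g * G g := by
  obtain ⟨hm, C, hC0, hC⟩ := hF
  obtain ⟨hm', D, hD0, hD⟩ := hG
  refine ⟨hm.mul hm', C * D, mul_nonneg hC0 hD0, fun g => ?_⟩
  rw [abs_mul, pow_add, mul_mul_mul_comm]
  have h0 := one_le_one_add_sum_abs g
  exact mul_le_mul (hC g) (hD g) (abs_nonneg _) (by positivity)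

theorem HasGrowth.add {k : ℕ} {F G : (ι → ℝ) → ℝ} (hF : HasGrowth k F) (hG : HasGrowth k G) :
    HasGrowth k fun g => F g + G g := by
  obtain ⟨hm, C, hC0, hC⟩ := hF
  obtain ⟨hm', D, hD0, hD⟩ := hG
  refine ⟨hm.add hm', C + D, add_nonneg hC0 hD0, fun g => ?_⟩
  rw [add_mul]
  exact (abs_add_le _ _).trans (add_le_add (hC g) (hD g))

theorem HasGrowth.const (a : ℝ) : HasGrowth 0 fun _ : ι → ℝ => a :=
  ⟨measurable_const, |a|, abs_nonneg a, fun g => by simp⟩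

theorem HasGrowth.const_mul {k : ℕ} {F : (ι → ℝ) → ℝ} (a : ℝ) (hF : HasGrowth k F) :
    HasGrowth k fun g => a * F g := by
  simpa using (HasGrowth.const a).mul hF

theorem HasGrowth.sum {α : Type} {k : ℕ} {F : α → (ι → ℝ) → ℝ} (t : Finset α)
    (hF : ∀ i ∈ t, HasGrowth k (F i)) : HasGrowth k fun g => ∑ i ∈ t, F i g := by
  classical
  induction t using Finset.induction_on with
  | empty => simpa using (HasGrowth.const 0).mono (Nat.zero_le k)
  | insert i t hi ih =>
    simp only [sum_insert hi]
    exact (hF i (mem_insert_self i t)).add (ih fun j hj => hF j (mem_insert_of_mem hj))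

theorem hasGrowth_of_bounded {F : (ι → ℝ) → ℝ} (hm : Measurable F) {C : ℝ} (hC0 : 0 ≤ C)
    (hC : ∀ g, |F g| ≤ C) : HasGrowth 0 F :=
  ⟨hm, C, hC0, fun g => by simpa using hC g⟩

theorem hasGrowth_coord (p : ι) : HasGrowth 1 fun g : ι → ℝ => g p :=
  ⟨measurable_pi_apply p, 1, zero_le_one, fun g => by
    have := single_le_sum (fun q _ => abs_nonneg (g q)) (mem_univ p)
    simp only [pow_one, one_mul]
    linarith⟩

end Growth

section TwoReplicas

variable {ι S : Type} [Fintype ι]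

/-- The rescaled and recentred energy. -/
noncomputable def fluct (s : S → ι → ℝ) (n δ : ℝ) (g : ι → ℝ) (σ : S) : ℝ :=
  energy s g σ / n - δ

@[fun_prop]
theorem measurable_fluct (s : S → ι → ℝ) (n δ : ℝ) (σ : S) : Measurable fun g => fluct s n δ g σ := by
  unfold fluct; fun_prop

theorem hasDerivAt_fluct_update [DecidableEq ι] (s : S → ι → ℝ) (n δ : ℝ) (g : ι → ℝ) (p : ι)
    (σ : S) (x : ℝ) :
    HasDerivAt (fun y => fluct s n δ (Function.update g p y) σ) (s σ p / n) x :=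
  ((hasDerivAt_energy_update s g p σ x).div_const n).sub_const δ

theorem hasGrowth_energy (s : S → ι → ℝ) (σ : S) : HasGrowth 1 fun g => energy s g σ :=
  HasGrowth.sum _ fun p _ => by simpa [mul_comm] using (hasGrowth_coord p).const_mul (s σ p)

theorem hasGrowth_fluct (s : S → ι → ℝ) (n δ : ℝ) (σ : S) :
    HasGrowth 1 fun g => fluct s n δ g σ := by
  have h := ((hasGrowth_energy s σ).const_mul n⁻¹).add
    ((HasGrowth.const (-δ)).mono (Nat.zero_le 1))
  refine (funext fun g => ?_ : (fun g => fluct s n δ g σ) = _) ▸ h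
  rw [fluct]; ring

theorem hasGrowth_comp_fluct (s : S → ι → ℝ) (n δ : ℝ) (σ : S) {f : ℝ → ℝ} {C : ℝ}
    (hm : Measurable f) (hC0 : 0 ≤ C) (hf : ∀ x, |f x| ≤ C) :
    HasGrowth 0 fun g => f (fluct s n δ g σ) :=
  hasGrowth_of_bounded (hm.comp (measurable_fluct s n δ σ)) hC0 fun _ => hf _

theorem hasGrowth_comp_fluct_of_linear (s : S → ι → ℝ) (n δ : ℝ) (σ : S) {f : ℝ → ℝ} {C : ℝ}
    (hm : Measurable f) (hC0 : 0 ≤ C) (hf : ∀ x, |f x| ≤ C * (1 + |x|)) :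
    HasGrowth 1 fun g => f (fluct s n δ g σ) := by
  obtain ⟨-, D, hD0, hD⟩ := hasGrowth_fluct s n δ σ
  refine ⟨hm.comp (measurable_fluct s n δ σ), C * (1 + D), by positivity, fun g => ?_⟩
  refine (hf _).trans ?_
  rw [mul_assoc]
  have h1 := hD g
  have h2 := one_le_one_add_sum_abs g
  rw [pow_one] at h1 ⊢
  gcongr
  linarith

variable [Fintype S] [Nonempty S]

theorem hasGrowth_wt (s : S → ι → ℝ) (θ : ℝ) (σ : S) : HasGrowth 0 fun g => wt s θ g σ :=
  hasGrowth_of_bounded (measurable_wt s θ σ) zero_le_one fun g => by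
    rw [abs_of_nonneg (wt_nonneg ..)]; exact wt_le_one ..

theorem hasGrowth_wt_mul_wt (s : S → ι → ℝ) (θ : ℝ) (σ τ : S) :
    HasGrowth 0 fun g => wt s θ g σ * wt s θ g τ :=
  (hasGrowth_wt s θ σ).mul (hasGrowth_wt s θ τ)

/-- Quenched average of the covariance with `σ`. -/
noncomputable def meanCorr (s : S → ι → ℝ) (θ : ℝ) (g : ι → ℝ) (σ : S) : ℝ :=
  ∑ ρ, wt s θ g ρ * corr s σ ρ

/-- The difference of the two sides of the Gaussian integration by parts formula for a function of
two replicas. -/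
noncomputable def ibpDefect (s : S → ι → ℝ) (θ n δ r : ℝ) (f f' w w' : ℝ → ℝ) (σ τ : S)
    (g : ι → ℝ) : ℝ :=
  ((Fintype.card ι - r * corr s σ τ) / n * (f' (fluct s n δ g σ) * w (fluct s n δ g τ))
    + (corr s σ τ - r * Fintype.card ι) / n * (f (fluct s n δ g σ) * w' (fluct s n δ g τ))
    + θ * ((1 - r) * (Fintype.card ι + corr s σ τ)
        - 2 * (meanCorr s θ g σ - r * meanCorr s θ g τ))
      * (f (fluct s n δ g σ) * w (fluct s n δ g τ))
    - (energy s g σ - r * energy s g τ) * (f (fluct s n δ g σ) * w (fluct s n δ g τ)))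
    * (wt s θ g σ * wt s θ g τ)

theorem integral_ibpDefect [DecidableEq ι] {s : S → ι → ℝ} (hs : ∀ σ p, s σ p * s σ p = 1)
    (θ n δ r : ℝ) {f f' w w' : ℝ → ℝ} {C : ℝ} (hC0 : 0 ≤ C)
    (hf : ∀ x, HasDerivAt f (f' x) x) (hw : ∀ x, HasDerivAt w (w' x) x)
    (hfm : Measurable f') (hwm : Measurable w')
    (hfC : ∀ x, |f x| ≤ C * (1 + |x|)) (hfC' : ∀ x, |f' x| ≤ C)
    (hwC : ∀ x, |w x| ≤ C) (hwC' : ∀ x, |w' x| ≤ C) (σ τ : S) :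
    Integrable (ibpDefect s θ n δ r f f' w w' σ τ) (gaussPi ι) ∧
      ∫ g, ibpDefect s θ n δ r f f' w w' σ τ g ∂gaussPi ι = 0 := by
  have hfm0 : Measurable f := (continuous_iff_continuousAt.2 fun x => (hf x).continuousAt).measurable
  have hwm0 : Measurable w := (continuous_iff_continuousAt.2 fun x => (hw x).continuousAt).measurable
  set Φ : (ι → ℝ) → ℝ := fun g =>
    f (fluct s n δ g σ) * w (fluct s n δ g τ) * (wt s θ g σ * wt s θ g τ) with hΦ
  set Φ' : ι → (ι → ℝ) → ℝ := fun p g =>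
    (s σ p / n * (f' (fluct s n δ g σ) * w (fluct s n δ g τ))
      + s τ p / n * (f (fluct s n δ g σ) * w' (fluct s n δ g τ))
      + θ * (s σ p + s τ p - 2 * mag s θ g p) * (f (fluct s n δ g σ) * w (fluct s n δ g τ)))
      * (wt s θ g σ * wt s θ g τ) with hΦ'
  have hK := hasGrowth_wt_mul_wt s θ σ τ
  have gf := hasGrowth_comp_fluct_of_linear s n δ σ hfm0 hC0 hfC
  have gf' := hasGrowth_comp_fluct s n δ σ hfm hC0 hfC'
  have gw := hasGrowth_comp_fluct s n δ τ hwm0 hC0 hwC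
  have gw' := hasGrowth_comp_fluct s n δ τ hwm hC0 hwC'
  have gm : ∀ p, HasGrowth 0 fun g => θ * (s σ p + s τ p - 2 * mag s θ g p) := fun p =>
    hasGrowth_of_bounded (by fun_prop) (C := |θ| * (|s σ p + s τ p| + 2)) (by positivity) fun g => by
      rw [abs_mul]
      gcongr
      refine (abs_sub _ _).trans ?_
      rw [abs_mul, abs_two]
      linarith [abs_mag_le hs θ g p]
  have gΦ : HasGrowth 1 Φ := (gf.mul gw).mul hK
  have gΦ' : ∀ p, HasGrowth 1 (Φ' p) := fun p =>
    (((((gf'.mul gw).const_mul _).mono (Nat.zero_le 1)).add ((gf.mul gw').const_mul _)).add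
      (by simpa using (gm p).mul (gf.mul gw))).mul hK
  have hder : ∀ p g x, HasDerivAt (fun y => Φ (Function.update g p y))
      (Φ' p (Function.update g p x)) x := by
    intro p g x
    have h1 := (hf _).comp x (hasDerivAt_fluct_update s n δ g p σ x)
    have h2 := (hw _).comp x (hasDerivAt_fluct_update s n δ g p τ x)
    have h3 := (hasDerivAt_wt_update s θ g p σ x).mul (hasDerivAt_wt_update s θ g p τ x)
    refine ((h1.mul h2).mul h3).congr_deriv ?_
    simp only [hΦ', Pi.mul_apply, Function.comp_apply]
    ring
  have hibp : ∀ p, ∫ g, g p * Φ g ∂gaussPi ι = ∫ g, Φ' p g ∂gaussPi ι := fun p =>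
    integral_coord_mul p (hder p) (gΦ.mono one_le_two).integrable
      ((hasGrowth_coord p).mul gΦ).integrable ((gΦ' p).mono one_le_two).integrable
  have hi : ∀ p, Integrable (fun g => Φ' p g - g p * Φ g) (gaussPi ι) := fun p =>
    ((gΦ' p).mono one_le_two).integrable.sub ((hasGrowth_coord p).mul gΦ).integrable
  have hdef : ibpDefect s θ n δ r f f' w w' σ τ
      = fun g => ∑ p, (s σ p - r * s τ p) * (Φ' p g - g p * Φ g) := by
    funext g
    have e1 : ∑ p, (s σ p - r * s τ p) * s σ p = Fintype.card ι - r * corr s σ τ := by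
      simp only [sub_mul, sum_sub_distrib, hs, mul_assoc, ← mul_sum, corr, mul_comm (s τ _)]
      simp
    have e2 : ∑ p, (s σ p - r * s τ p) * s τ p = corr s σ τ - r * Fintype.card ι := by
      simp only [sub_mul, sum_sub_distrib, hs, mul_assoc, ← mul_sum, corr]
      simp
    have e3 : ∑ p, (s σ p - r * s τ p) * mag s θ g p
        = meanCorr s θ g σ - r * meanCorr s θ g τ := by
      simp only [sub_mul, sum_sub_distrib, mul_assoc, ← mul_sum, sum_coeff_mul_mag, meanCorr]
    have e4 : ∑ p, (s σ p - r * s τ p) * g p = energy s g σ - r * energy s g τ := by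
      simp only [sub_mul, sum_sub_distrib, mul_assoc, ← mul_sum, energy, mul_comm (g _)]
    have e5 : (1 - r) * (Fintype.card ι + corr s σ τ)
        = (Fintype.card ι - r * corr s σ τ) + (corr s σ τ - r * Fintype.card ι) := by ring
    rw [ibpDefect, e5, ← e1, ← e2, ← e3, ← e4]
    simp only [hΦ, hΦ', sum_div, sum_mul, mul_sum, ← sum_add_distrib, ← sum_sub_distrib]
    exact sum_congr rfl fun p _ => by ring
  rw [hdef]
  refine ⟨integrable_finsetSum _ fun p _ => (hi p).const_mul _, ?_⟩
  rw [integral_finsetSum _ fun p _ => (hi p).const_mul _]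
  refine sum_eq_zero fun p _ => ?_
  rw [integral_const_mul, integral_sub ((gΦ' p).mono one_le_two).integrable
    ((hasGrowth_coord p).mul gΦ).integrable, hibp, sub_self, mul_zero]

end TwoReplicas

/-! ### Stein's equation -/

theorem integral_Ioi_exp_neg_sq_le {c : ℝ} (hc : 0 < c) (x : ℝ) :
    ∫ t in Set.Ioi x, exp (-t ^ 2) ≤ exp (c ^ 2 - 2 * c * x) / (2 * c) := by
  have hneg : -(2 * c) < 0 := by linarith
  calc ∫ t in Set.Ioi x, exp (-t ^ 2) ≤ ∫ t in Set.Ioi x, exp (c ^ 2) * exp (-(2 * c) * t) := by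
        refine integral_mono_of_nonneg (Filter.Eventually.of_forall fun t => (exp_pos _).le)
          ((integrableOn_exp_mul_Ioi hneg x).const_mul _) (Filter.Eventually.of_forall fun t => ?_)
        simp only
        rw [← exp_add]
        exact exp_le_exp.2 (by nlinarith [sq_nonneg (t - c)])
    _ = _ := by
        rw [integral_const_mul, integral_exp_mul_Ioi hneg, neg_div_neg_eq, ← mul_div_assoc,
          ← exp_add]
        congr 2
        ring

theorem integrable_exp_neg_sq : Integrable fun t : ℝ => exp (-t ^ 2) := by
  simpa using integrable_exp_neg_mul_sq one_pos

theorem abs_integral_Ioi_le {v : ℝ → ℝ} {V x : ℝ} (hv : ∀ t, |v t| ≤ V) :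
    |∫ t in Set.Ioi x, v t * exp (-t ^ 2)| ≤ V * ∫ t in Set.Ioi x, exp (-t ^ 2) := by
  rw [← integral_const_mul]
  refine norm_integral_le_of_norm_le (f := fun t => v t * exp (-t ^ 2))
    (integrable_exp_neg_sq.integrableOn.const_mul V) (Filter.Eventually.of_forall fun t => ?_)
  rw [norm_mul, norm_eq_abs, norm_eq_abs, abs_exp]
  exact mul_le_mul_of_nonneg_right (hv t) (exp_pos _).le

theorem gaussian_tail_bounds {v : ℝ → ℝ} {V x : ℝ} (hv : ∀ t, |v t| ≤ V) (hx : 0 ≤ x) :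
    |2 * exp (x ^ 2) * ∫ t in Set.Ioi x, v t * exp (-t ^ 2)| ≤ 3 * V ∧
      |x * (2 * exp (x ^ 2) * ∫ t in Set.Ioi x, v t * exp (-t ^ 2))| ≤ V := by
  have hV : 0 ≤ V := (abs_nonneg _).trans (hv 0)
  have h := abs_integral_Ioi_le (x := x) hv
  set T := ∫ t in Set.Ioi x, exp (-t ^ 2)
  set A := ∫ t in Set.Ioi x, v t * exp (-t ^ 2)
  have hT : ∀ c, 0 < c → 2 * exp (x ^ 2) * T * c ≤ exp ((c - x) ^ 2) := fun c hc => by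
    have h1 := integral_Ioi_exp_neg_sq_le hc x
    rw [le_div_iff₀ (by positivity)] at h1
    have h2 := mul_le_mul_of_nonneg_left h1 (exp_pos (x ^ 2)).le
    rw [← exp_add] at h2
    calc _ = exp (x ^ 2) * (T * (2 * c)) := by ring
      _ ≤ _ := h2.trans (le_of_eq (by congr 1; ring))
  have hT0 : 0 ≤ T := integral_nonneg fun t => (exp_pos _).le
  have habs : |2 * exp (x ^ 2) * A| ≤ 2 * exp (x ^ 2) * T * V := by
    rw [abs_mul, abs_of_pos (by positivity : 0 < 2 * exp (x ^ 2)), mul_assoc _ T, mul_comm T]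
    gcongr
  refine ⟨habs.trans ?_, ?_⟩
  · gcongr
    have h1 := hT (x + 1 / 2) (by positivity)
    have h2 : exp ((x + 1 / 2 - x) ^ 2) ≤ 3 / 2 := by
      have h3 := one_sub_le_exp_neg (1 / 4 : ℝ)
      rw [exp_neg] at h3
      have h4 : (x + 1 / 2 - x) ^ 2 = (1 / 4 : ℝ) := by ring
      rw [h4]
      have h5 := mul_inv_cancel₀ (exp_pos (1 / 4 : ℝ)).ne'
      nlinarith [exp_pos (1 / 4 : ℝ)]
    have h6 : 0 ≤ 2 * exp (x ^ 2) * T := by positivity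
    nlinarith
  · rcases hx.eq_or_lt with rfl | hx
    · simpa using hV
    rw [abs_mul, abs_of_pos hx]
    have h1 := hT x hx
    rw [sub_self] at h1
    norm_num at h1
    calc x * |2 * exp (x ^ 2) * A| ≤ x * (2 * exp (x ^ 2) * T * V) := by gcongr
      _ = 2 * exp (x ^ 2) * T * x * V := by ring
      _ ≤ 1 * V := by gcongr
      _ = V := one_mul V

/-- Bounded solutions of Stein's equation for the Gaussian law of variance `1 / 2`. -/
theorem exists_stein_solution {v : ℝ → ℝ} {V : ℝ} (hc : Continuous v) (hv : ∀ t, |v t| ≤ V)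
    (h0 : ∫ t, v t * exp (-t ^ 2) = 0) :
    ∃ f f' : ℝ → ℝ, (∀ x, HasDerivAt f (f' x) x) ∧ Measurable f' ∧
      (∀ x, f' x / 2 - x * f x = v x) ∧ (∀ x, |f x| ≤ 3 * V) ∧ (∀ x, |x * f x| ≤ V) ∧
      ∀ x, |f' x| ≤ 4 * V := by
  have hint : Integrable fun t => v t * exp (-t ^ 2) :=
    (integrable_exp_neg_sq.const_mul V).mono' (by fun_prop)
      (Filter.Eventually.of_forall fun t => by
        rw [norm_mul, norm_eq_abs, norm_eq_abs, abs_exp]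
        exact mul_le_mul_of_nonneg_right (hv t) (exp_pos _).le)
  set I : ℝ → ℝ := fun x => ∫ t in Set.Iic x, v t * exp (-t ^ 2) with hI
  set f : ℝ → ℝ := fun x => 2 * exp (x ^ 2) * I x with hf
  have hder : ∀ x, HasDerivAt I (v x * exp (-x ^ 2)) x := fun x => by
    have h1 : I = fun y => I 0 + ∫ t in (0 : ℝ)..y, v t * exp (-t ^ 2) := by
      funext y
      rw [← intervalIntegral.integral_Iic_sub_Iic hint.integrableOn hint.integrableOn]
      simp only [hI]
      ring
    rw [h1]
    exact (Continuous.integral_hasStrictDerivAt (by fun_prop) 0 x).hasDerivAt.const_add _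
  have hfd : ∀ x, HasDerivAt f (2 * (x * f x) + 2 * v x) x := fun x => by
    have h1 : HasDerivAt (fun y : ℝ => 2 * exp (y ^ 2)) (2 * (exp (x ^ 2) * (2 * x))) x := by
      simpa using ((hasDerivAt_pow 2 x).exp).const_mul 2
    refine (h1.mul (hder x)).congr_deriv ?_
    have h2 : exp (x ^ 2) * exp (-x ^ 2) = 1 := by rw [← exp_add]; simp
    simp only [hf]
    linear_combination 2 * v x * h2
  have hpos : ∀ x, f x = -(2 * exp (x ^ 2) * ∫ t in Set.Ioi x, v t * exp (-t ^ 2)) := fun x => by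
    have := intervalIntegral.integral_Iic_add_Ioi (b := x) hint.integrableOn hint.integrableOn
    rw [h0] at this
    simp only [hf, hI]
    linear_combination 2 * exp (x ^ 2) * this
  have hneg : ∀ x, f x
      = 2 * exp ((-x) ^ 2) * ∫ t in Set.Ioi (-x), v (-t) * exp (-t ^ 2) := fun x => by
    have := integral_comp_neg_Iic x fun t => v (-t) * exp (-t ^ 2)
    simp only [neg_neg, neg_sq] at this
    simp only [hf, hI, this, neg_sq]
  have hb : ∀ x, |f x| ≤ 3 * V ∧ |x * f x| ≤ V := fun x => by
    rcases le_total 0 x with hx | hx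
    · have := gaussian_tail_bounds hv hx
      rw [hpos, mul_neg, abs_neg, abs_neg]
      exact this
    · have := gaussian_tail_bounds (fun t => hv (-t)) (neg_nonneg.2 hx)
      rw [← hneg, neg_mul, abs_neg] at this
      exact this
  have hfc : Continuous f := continuous_iff_continuousAt.2 fun x => (hfd x).continuousAt
  refine ⟨f, _, hfd, by fun_prop, fun x => by ring, fun x => (hb x).1, fun x => (hb x).2,
    fun x => ?_⟩
  have h1 := abs_add_le (2 * (x * f x)) (2 * v x)
  rw [abs_mul, abs_mul 2, abs_two] at h1
  linarith [(hb x).2, hv x]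

/-! ### Quantitative central limit theorem for smooth test functions -/

/-- The remainder terms in the two-replica Stein identity are of order `1 / n`. -/
theorem stein_remainder_le {n ε r a y α α' W A₁ A₂ A₃ A₄ A₅ : ℝ} (hn : 2 ≤ n) (hε0 : 0 ≤ ε)
    (hε : n * ε ^ 2 ≤ 1) (hr : |r| ≤ 1) (hra : n * |r| ≤ 4 * |a|) (hW : 0 ≤ W)
    (h₁ : |A₁| ≤ 4 * W) (h₂ : |A₂| ≤ 3 * W) (h₃ : |A₃| ≤ 12 * W) (h₄ : |A₄| ≤ 9 * W)
    (h₅ : |A₅| ≤ 3 * W) :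
    n * ((r ^ 2 / 2 + (1 - r ^ 2) / (2 * n)) * A₁
      - (ε / 2 * r ^ 2 + 2 * ε * r * α' + r * y) * A₂
      - n * ε / 2 * r * (1 - r) * (r ^ 2 / 2 + (1 - r ^ 2) / (2 * n)) * A₃
      + n * ε / 2 * r * (1 - r) * (n * ε / 2 * r * (1 - r) - ε / 2 * (1 - r ^ 2)
        - 2 * ε * (α' - r * α)) * A₄
      + n * ε / 2 * r * (1 - r) * r * A₅)
      ≤ 500 * W * (1 + a ^ 2 + y ^ 2 + α ^ 2 + α' ^ 2) := by
  have hn0 : 0 < n := by linarith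
  have hε1 : ε ≤ 1 := by nlinarith
  set b := |a|
  have hb0 : 0 ≤ b := abs_nonneg a
  have hb2 : a ^ 2 = b ^ 2 := (sq_abs a).symm
  have hr0 : 0 ≤ |r| := abs_nonneg r
  have hr2 : r ^ 2 = |r| ^ 2 := (sq_abs r).symm
  have hr21 : r ^ 2 ≤ 1 := by rw [hr2]; exact pow_le_one₀ hr0 hr
  have h1r : |1 - r| ≤ 2 := by linarith [abs_sub 1 r, abs_one (α := ℝ)]
  set q := n * ε / 2 * r * (1 - r) with hq
  have hT0 : 0 ≤ n * |r| := by positivity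
  have hT2 : (n * |r|) ^ 2 ≤ 16 * b ^ 2 := by
    calc _ ≤ (4 * b) ^ 2 := pow_le_pow_left₀ hT0 hra 2
      _ = _ := by ring
  have hqa : |q| ≤ ε * (n * |r|) := by
    rw [hq, abs_mul, abs_mul, abs_of_nonneg (by positivity : 0 ≤ n * ε / 2)]
    calc _ ≤ n * ε / 2 * |r| * 2 := by gcongr
      _ = _ := by ring
  have hqb : |q| ≤ 4 * b := hqa.trans (by nlinarith)
  have hnq : n * |q| * ε ≤ 4 * b := by
    calc n * |q| * ε ≤ n * (ε * (n * |r|)) * ε := by gcongr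
      _ = (n * ε ^ 2) * (n * |r|) := by ring
      _ ≤ 1 * (4 * b) := by gcongr
      _ = _ := one_mul _
  have hnr2 : n * r ^ 2 ≤ 4 * b := by
    rw [hr2]
    calc n * |r| ^ 2 = n * |r| * |r| := by ring
      _ ≤ 4 * b * 1 := by gcongr
      _ = _ := mul_one _
  have hnr2' : n * r ^ 2 ≤ 8 * b ^ 2 := by
    rw [hr2]
    nlinarith [mul_nonneg hn0.le (sq_nonneg |r|)]
  set ρ := r ^ 2 / 2 + (1 - r ^ 2) / (2 * n) with hρ
  have hnρ : n * ρ = n * r ^ 2 / 2 + (1 - r ^ 2) / 2 := by rw [hρ]; field_simp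
  have hρ0 : 0 ≤ n * ρ := by
    rw [hnρ]
    nlinarith [mul_nonneg hn0.le (sq_nonneg r)]
  have c₁ : |n * ρ| ≤ 4 * b ^ 2 + 1 / 2 := by
    rw [abs_of_nonneg hρ0, hnρ]; nlinarith [sq_nonneg r]
  have c₂ : |n * (ε / 2 * r ^ 2 + 2 * ε * r * α' + r * y)|
      ≤ 4 * b ^ 2 + 8 * b * |α'| + 4 * b * |y| := by
    have e : n * (ε / 2 * r ^ 2 + 2 * ε * r * α' + r * y)
        = ε * (n * r ^ 2 / 2) + ε * (2 * (n * r) * α') + n * r * y := by ring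
    rw [e]
    refine (abs_add_three _ _ _).trans ?_
    have hp : 0 ≤ n * r ^ 2 / 2 := by positivity
    rw [abs_mul ε, abs_mul ε, abs_mul (2 * (n * r)), abs_mul 2, abs_mul (n * r), abs_mul n, abs_two,
      abs_of_nonneg hε0, abs_of_nonneg hp, abs_of_pos hn0]
    have i1 : ε * (n * r ^ 2 / 2) ≤ 1 * (4 * b ^ 2) := by
      gcongr
      linarith
    have i2 : ε * (2 * (n * |r|) * |α'|) ≤ 1 * (2 * (4 * b) * |α'|) := by gcongr
    have i3 : n * |r| * |y| ≤ 4 * b * |y| := by gcongr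
    linarith
  have c₃ : |q * (n * ρ)| ≤ 8 * b ^ 2 + 2 * b := by
    rw [abs_mul, abs_of_nonneg hρ0, hnρ]
    calc _ ≤ 4 * b * (4 * b / 2 + 1 / 2) := by
          gcongr
          linarith [sq_nonneg r]
      _ = _ := by ring
  have c₄ : |n * q * (q - ε / 2 * (1 - r ^ 2) - 2 * ε * (α' - r * α))|
      ≤ 16 * b ^ 2 + 2 * b + 8 * b * (|α'| + |α|) := by
    have e : n * q * (q - ε / 2 * (1 - r ^ 2) - 2 * ε * (α' - r * α))
        = n * q * q + n * q * ε * (-((1 - r ^ 2) / 2)) + n * q * ε * (-2 * (α' - r * α)) := by ring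
    rw [e]
    refine (abs_add_three _ _ _).trans ?_
    have j0 : |n * q * ε| ≤ 4 * b := by
      rwa [abs_mul, abs_mul, abs_of_pos hn0, abs_of_nonneg hε0]
    have j1 : |n * q * q| ≤ 16 * b ^ 2 := by
      rw [abs_mul, abs_mul, abs_of_pos hn0]
      calc n * |q| * |q| ≤ n * |q| * (ε * (n * |r|)) := by gcongr
        _ = n * |q| * ε * (n * |r|) := by ring
        _ ≤ 4 * b * (4 * b) := by gcongr
        _ = _ := by ring
    have j2 : |(-((1 - r ^ 2) / 2))| ≤ 1 / 2 := by
      rw [abs_neg, abs_of_nonneg (by linarith)]; linarith [sq_nonneg r]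
    have j3 : |-2 * (α' - r * α)| ≤ 2 * (|α'| + |α|) := by
      rw [abs_mul, abs_neg, abs_two]
      gcongr
      refine (abs_sub _ _).trans ?_
      rw [abs_mul]
      gcongr
      exact mul_le_of_le_one_left (abs_nonneg _) hr
    rw [abs_mul (n * q * ε), abs_mul (n * q * ε)]
    calc _ ≤ 16 * b ^ 2 + 4 * b * (1 / 2) + 4 * b * (2 * (|α'| + |α|)) := by gcongr
      _ = _ := by ring
  have c₅ : |q * (n * r)| ≤ 16 * b ^ 2 := by
    rw [abs_mul, abs_mul n, abs_of_pos hn0]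
    calc _ ≤ 4 * b * (4 * b) := by gcongr
      _ = _ := by ring
  have key : ∀ {c A B k : ℝ}, |c| ≤ B → |A| ≤ k * W → c * A ≤ B * (k * W) := fun {c A B k} h h' =>
    (le_abs_self _).trans (by
      rw [abs_mul]; exact mul_le_mul h h' (abs_nonneg _) ((abs_nonneg _).trans h))
  have k₁ := key c₁ h₁
  have k₂ := key ((abs_neg _).trans_le c₂) h₂
  have k₃ := key ((abs_neg _).trans_le c₃) h₃
  have k₄ := key c₄ h₄
  have k₅ := key c₅ h₅
  have fin : 4 * (4 * b ^ 2 + 1 / 2) + 3 * (4 * b ^ 2 + 8 * b * |α'| + 4 * b * |y|)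
      + 12 * (8 * b ^ 2 + 2 * b) + 9 * (16 * b ^ 2 + 2 * b + 8 * b * (|α'| + |α|))
      + 3 * (16 * b ^ 2) ≤ 500 * (1 + b ^ 2 + |y| ^ 2 + |α| ^ 2 + |α'| ^ 2) := by
    linarith [two_mul_le_add_sq b |α'|, two_mul_le_add_sq b |α|, two_mul_le_add_sq b |y|,
      two_mul_le_add_sq b 1, sq_nonneg |α'|, sq_nonneg |α|, sq_nonneg |y|, sq_nonneg b]
  have fin' := mul_le_mul_of_nonneg_right fin hW
  rw [sq_abs y, sq_abs α, sq_abs α'] at fin'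
  rw [hb2]
  linarith

section SmoothCLT

variable {ι S : Type} [Fintype ι] [Fintype S]

theorem ibpDefect_eq (s : S → ι → ℝ) {n ε r : ℝ} (hn : 0 < n)
    (hcard : 2 * (Fintype.card ι : ℝ) = n ^ 2 - n) (f f' w w' : ℝ → ℝ) {σ τ : S}
    (hr : corr s σ τ = r * Fintype.card ι) (g : ι → ℝ) :
    ibpDefect s ε n (n * ε / 2) r f f' w w' σ τ g
      = n * (((1 / 2 - (r ^ 2 / 2 + (1 - r ^ 2) / (2 * n))) * f' (fluct s n (n * ε / 2) g σ)
          + ((n * ε / 2 - ε / 2) * (1 - r ^ 2)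
            - 2 * ε * (meanCorr s ε g σ / n - r * (meanCorr s ε g τ / n))
            - (fluct s n (n * ε / 2) g σ - r * fluct s n (n * ε / 2) g τ + n * ε / 2 * (1 - r)))
            * f (fluct s n (n * ε / 2) g σ)) * w (fluct s n (n * ε / 2) g τ)
          * (wt s ε g σ * wt s ε g τ)) := by
  have hP : (Fintype.card ι : ℝ) = (n ^ 2 - n) / 2 := by linarith
  have hX : ∀ ρ, energy s g ρ = n * (fluct s n (n * ε / 2) g ρ + n * ε / 2) := fun ρ => by
    rw [fluct]; field_simp; ring
  rw [ibpDefect, hr, hX σ, hX τ, hP]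
  field_simp
  ring

/-- Two applications of Gaussian integration by parts compare the product of two replicas with its
factorized part. -/
theorem stein_pair_le {s : S → ι → ℝ} (hs : ∀ σ p, s σ p * s σ p = 1) {n ε V : ℝ} (hn : 2 ≤ n)
    (hcard : 2 * (Fintype.card ι : ℝ) = n ^ 2 - n) (hε0 : 0 ≤ ε) (hε : n * ε ^ 2 ≤ 1)
    {v v' f f' : ℝ → ℝ} (hv : ∀ x, |v x| ≤ V) (hst : ∀ x, f' x / 2 - x * f x = v x)
    (hf : ∀ x, |f x| ≤ 3 * V) (hxf : ∀ x, |x * f x| ≤ V) (hf' : ∀ x, |f' x| ≤ 4 * V) (σ τ : S)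
    {r : ℝ} (hr : corr s σ τ = r * Fintype.card ι) (g : ι → ℝ) :
    n * ((v (fluct s n (n * ε / 2) g σ) * v (fluct s n (n * ε / 2) g τ)
      - (ε / 2 + 2 * ε * (meanCorr s ε g σ / n))
        * (f (fluct s n (n * ε / 2) g σ) * v (fluct s n (n * ε / 2) g τ)))
        * (wt s ε g σ * wt s ε g τ))
      ≤ 500 * V ^ 2 * (1 + (corr s σ τ / n) ^ 2 + fluct s n (n * ε / 2) g τ ^ 2
          + (meanCorr s ε g σ / n) ^ 2 + (meanCorr s ε g τ / n) ^ 2) * (wt s ε g σ * wt s ε g τ)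
        + (ibpDefect s ε n (n * ε / 2) r f f' v v' σ τ g
          - n * ε / 2 * r * (1 - r) * ibpDefect s ε n (n * ε / 2) r f f' f f' τ σ g) := by
  have hn0 : 0 < n := by linarith
  have hP : (Fintype.card ι : ℝ) = (n ^ 2 - n) / 2 := by linarith
  have hP0 : (0 : ℝ) < Fintype.card ι := by rw [hP]; nlinarith
  have hV : 0 ≤ V := (abs_nonneg _).trans (hv 0)
  have hr1 : |r| ≤ 1 := by
    have h := abs_corr_le hs σ τ
    rw [hr, abs_mul, abs_of_pos hP0] at h
    exact le_of_mul_le_mul_right (by linarith) hP0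
  have hra : n * |r| ≤ 4 * |corr s σ τ / n| := by
    rw [hr, hP, abs_div, abs_mul, abs_of_pos hn0, ← hP, abs_of_pos hP0, hP,
      ← mul_div_assoc, le_div_iff₀ hn0]
    nlinarith [mul_nonneg (mul_nonneg (abs_nonneg r) hn0.le) (sub_nonneg.2 hn)]
  rw [ibpDefect_eq s hn0 hcard f f' v v' hr,
    ibpDefect_eq s hn0 hcard f f' f f' ((corr_comm s τ σ).trans hr)]
  set x := fluct s n (n * ε / 2) g σ
  set y := fluct s n (n * ε / 2) g τ
  set α := meanCorr s ε g σ / n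
  set α' := meanCorr s ε g τ / n
  have hK : 0 ≤ wt s ε g σ * wt s ε g τ := mul_nonneg (wt_nonneg ..) (wt_nonneg ..)
  have hm : ∀ {A B k l : ℝ}, 0 ≤ k → |A| ≤ k * V → |B| ≤ l * V → |A * B| ≤ k * l * V ^ 2 :=
    fun {A B k l} hk hA hB => by
      rw [abs_mul]
      exact (mul_le_mul hA hB (abs_nonneg _) (by positivity)).trans (le_of_eq (by ring))
  have hv1 : |v y| ≤ 1 * V := by rw [one_mul]; exact hv y
  have hx1 : |x * f x| ≤ 1 * V := by rw [one_mul]; exact hxf x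
  have hR := stein_remainder_le (y := y) (α := α) (α' := α') hn hε0 hε hr1 hra (sq_nonneg V)
    (A₁ := f' x * v y) (A₂ := f x * v y) (A₃ := f' y * f x) (A₄ := f x * f y)
    (A₅ := x * f x * f y)
    (by simpa using hm (by norm_num) (hf' x) hv1) (by simpa using hm (by norm_num) (hf x) hv1)
    ((hm (by norm_num) (hf' y) (hf x)).trans (by norm_num))
    ((hm (by norm_num) (hf x) (hf y)).trans (by norm_num))
    (by simpa using hm (by norm_num) hx1 (hf y))
  have hR' := mul_le_mul_of_nonneg_right hR hK
  refine le_trans (le_of_eq ?_) (add_le_add_left hR' _)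
  rw [← hst x, ← hst y]
  ring

/-- A priori bound on the second moment of the energy. -/
theorem fluct_sq_pair_le (s : S → ι → ℝ) {n ε : ℝ} (hn : 2 ≤ n)
    (hcard : 2 * (Fintype.card ι : ℝ) = n ^ 2 - n) (hε : n * ε ^ 2 ≤ 1) (σ τ : S)
    (g : ι → ℝ) :
    fluct s n (n * ε / 2) g σ ^ 2 * (wt s ε g σ * wt s ε g τ)
      ≤ (2 + 4 * (corr s σ τ / n) ^ 2 + 8 * (meanCorr s ε g σ / n) ^ 2)
          * (wt s ε g σ * wt s ε g τ)
        - 2 / n * ibpDefect s ε n (n * ε / 2) 0 (fun x => x) (fun _ => 1) (fun _ => 1)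
          (fun _ => 0) σ τ g := by
  have hn0 : 0 < n := by linarith
  have hε1 : ε ^ 2 ≤ 1 := by nlinarith [sq_nonneg ε]
  have hP : (Fintype.card ι : ℝ) = (n ^ 2 - n) / 2 := by linarith
  have hX : energy s g σ = n * (fluct s n (n * ε / 2) g σ + n * ε / 2) := by
    rw [fluct]; field_simp; ring
  have hK : 0 ≤ wt s ε g σ * wt s ε g τ := mul_nonneg (wt_nonneg ..) (wt_nonneg ..)
  have hD : ibpDefect s ε n (n * ε / 2) 0 (fun x => x) (fun _ => 1) (fun _ => 1) (fun _ => 0) σ τ g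
      = n * ((1 / 2 - 1 / (2 * n) + ε * (corr s σ τ / n - 2 * (meanCorr s ε g σ / n) - 1 / 2)
          * fluct s n (n * ε / 2) g σ - fluct s n (n * ε / 2) g σ ^ 2)
        * (wt s ε g σ * wt s ε g τ)) := by
    rw [ibpDefect, hX, hP]
    field_simp
    ring
  rw [hD, ← mul_assoc (2 / n), div_mul_cancel₀ _ hn0.ne', ← sub_nonneg]
  set x := fluct s n (n * ε / 2) g σ
  set a := corr s σ τ / n
  set α := meanCorr s ε g σ / n
  have h1 : 0 ≤ 1 / (2 * n) := by positivity
  have h2 : 0 ≤ 2 + 4 * a ^ 2 + 8 * α ^ 2 + x ^ 2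
      - 2 * (1 / 2 - 1 / (2 * n) + ε * (a - 2 * α - 1 / 2) * x) := by
    have i1 : ε ^ 2 * a ^ 2 ≤ 1 * a ^ 2 := by gcongr
    have i2 : ε ^ 2 * α ^ 2 ≤ 1 * α ^ 2 := by gcongr
    nlinarith [sq_nonneg (x + 2 * ε), sq_nonneg (x - 4 * ε * a), sq_nonneg (x + 4 * ε * α)]
  exact (mul_nonneg h2 hK).trans (le_of_eq (by ring))

variable [Nonempty S]

/-- Second moment of quenched averages of smooth centred functions of the energy. -/
theorem integral_sq_average_le [DecidableEq ι] {s : S → ι → ℝ} (hs : ∀ σ p, s σ p * s σ p = 1)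
    {n ε V C : ℝ} (hn : 2 ≤ n) (hcard : 2 * (Fintype.card ι : ℝ) = n ^ 2 - n) (hε0 : 0 ≤ ε)
    (hε : n * ε ^ 2 ≤ 1) {v v' : ℝ → ℝ} (hvd : ∀ x, HasDerivAt v (v' x) x) (hvm : Measurable v')
    (hv : ∀ x, |v x| ≤ V) (hvC : ∀ x, |v' x| ≤ C) (h0 : ∫ t, v t * exp (-t ^ 2) = 0) :
    ∫ g, (∑ σ, wt s ε g σ * v (fluct s n (n * ε / 2) g σ)) ^ 2 ∂gaussPi ι
      ≤ V ^ 2 / n * (3005 + 15072 *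
        (∫ g, ∑ σ, ∑ τ, wt s ε g σ * wt s ε g τ * corr s σ τ ^ 2 ∂gaussPi ι) / n ^ 2) := by
  have hn0 : 0 < n := by linarith
  have hV : 0 ≤ V := (abs_nonneg _).trans (hv 0)
  have hC : 0 ≤ C := (abs_nonneg _).trans (hvC 0)
  have hP0 : (0 : ℝ) < Fintype.card ι := by nlinarith
  obtain ⟨f, f', hfd, hfm, hst, hf, hxf, hf'⟩ :=
    exists_stein_solution (continuous_iff_continuousAt.2 fun x => (hvd x).continuousAt) hv h0
  set r : S → S → ℝ := fun σ τ => corr s σ τ / Fintype.card ι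
  have hr : ∀ σ τ, corr s σ τ = r σ τ * Fintype.card ι := fun σ τ => (div_mul_cancel₀ _ hP0.ne').symm
  set L := 4 * V + C + 1
  have hlin : ∀ x, |f x| ≤ L * (1 + |x|) := fun x =>
    (hf x).trans (by nlinarith [mul_nonneg (by positivity : 0 ≤ L) (abs_nonneg x)])
  have hE1 := fun σ τ => integral_ibpDefect hs ε n (n * ε / 2) (r σ τ) (by positivity : 0 ≤ L)
    hfd hvd hfm hvm hlin (fun x => (hf' x).trans (by linarith)) (fun x => (hv x).trans (by linarith))
    (fun x => (hvC x).trans (by linarith)) σ τ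
  have hE2 := fun σ τ => integral_ibpDefect hs ε n (n * ε / 2) (r σ τ) (by positivity : 0 ≤ L)
    hfd hfd hfm hfm hlin (fun x => (hf' x).trans (by linarith)) (fun x => (hf x).trans (by linarith))
    (fun x => (hf' x).trans (by linarith)) τ σ
  have hE0 := fun σ τ => integral_ibpDefect hs ε n (n * ε / 2) 0 zero_le_one (f := fun x => x)
    (w := fun _ => (1 : ℝ)) hasDerivAt_id' (fun x => hasDerivAt_const x 1)
    measurable_const measurable_const (fun x => by linarith [abs_nonneg x]) (by simp)
    (by simp) (by simp) σ τ
  set D : (ι → ℝ) → ℝ := fun g => ∑ σ, ∑ τ, (ibpDefect s ε n (n * ε / 2) (r σ τ) f f' v v' σ τ g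
    - n * ε / 2 * r σ τ * (1 - r σ τ) * ibpDefect s ε n (n * ε / 2) (r σ τ) f f' f f' τ σ g) with hD
  set D' : (ι → ℝ) → ℝ := fun g => ∑ σ, ∑ τ, ibpDefect s ε n (n * ε / 2) 0 (fun x => x)
    (fun _ => 1) (fun _ => 1) (fun _ => 0) σ τ g with hD'
  set A : (ι → ℝ) → ℝ := fun g => ∑ σ, ∑ τ, wt s ε g σ * wt s ε g τ * corr s σ τ ^ 2 with hA
  have hi : ∀ σ τ, Integrable (fun g => ibpDefect s ε n (n * ε / 2) (r σ τ) f f' v v' σ τ g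
      - n * ε / 2 * r σ τ * (1 - r σ τ) * ibpDefect s ε n (n * ε / 2) (r σ τ) f f' f f' τ σ g)
      (gaussPi ι) := fun σ τ => (hE1 σ τ).1.sub ((hE2 σ τ).1.const_mul _)
  have hDi : Integrable D (gaussPi ι) := integrable_finsetSum _ fun σ _ =>
    integrable_finsetSum _ fun τ _ => hi σ τ
  have hDi' : Integrable D' (gaussPi ι) := integrable_finsetSum _ fun σ _ =>
    integrable_finsetSum _ fun τ _ => (hE0 σ τ).1
  have hAi : Integrable A (gaussPi ι) := HasGrowth.integrable (HasGrowth.mono (Nat.zero_le 2)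
    (HasGrowth.sum _ fun σ _ => HasGrowth.sum _ fun τ _ =>
      (hasGrowth_wt_mul_wt s ε σ τ).mul (HasGrowth.const _)))
  have hD0 : ∫ g, D g ∂gaussPi ι = 0 := by
    rw [integral_finsetSum _ fun σ _ => integrable_finsetSum _ fun τ _ => hi σ τ]
    refine sum_eq_zero fun σ _ => ?_
    rw [integral_finsetSum _ fun τ _ => hi σ τ]
    refine sum_eq_zero fun τ _ => ?_
    rw [integral_sub (hE1 σ τ).1 ((hE2 σ τ).1.const_mul _), integral_const_mul, (hE1 σ τ).2,
      (hE2 σ τ).2, mul_zero, sub_zero]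
  have hD0' : ∫ g, D' g ∂gaussPi ι = 0 := by
    rw [integral_finsetSum _ fun σ _ => integrable_finsetSum _ fun τ _ => (hE0 σ τ).1]
    refine sum_eq_zero fun σ _ => ?_
    rw [integral_finsetSum _ fun τ _ => (hE0 σ τ).1]
    exact sum_eq_zero fun τ _ => (hE0 σ τ).2
  have hpt : ∀ g, (∑ σ, wt s ε g σ * v (fluct s n (n * ε / 2) g σ)) ^ 2
      ≤ V ^ 2 / n * (3005 + 15072 * (A g / n ^ 2)) + 2 / n * D g - 2000 * V ^ 2 / n ^ 2 * D' g := by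
    intro g
    have hw := fun σ => wt_nonneg s ε g σ
    have hw1 := sum_wt s ε g
    set w := wt s ε g
    set x := fluct s n (n * ε / 2) g
    set α : S → ℝ := fun σ => meanCorr s ε g σ / n with hα
    set Φ := ∑ σ, w σ * v (x σ) with hΦ
    set F := ∑ σ, w σ * f (x σ) with hF
    set G := ∑ σ, w σ * (α σ * f (x σ)) with hG
    set Y := ∑ σ, w σ * x σ ^ 2 with hY
    set B := ∑ σ, w σ * α σ ^ 2 with hB
    have hAn : ∑ σ, ∑ τ, (corr s σ τ / n) ^ 2 * (w σ * w τ) = A g / n ^ 2 := by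
      simp only [hA, sum_div]
      exact sum_congr rfl fun σ _ => sum_congr rfl fun τ _ => by ring
    have hleft : ∀ h : S → ℝ, ∑ σ, ∑ τ, h σ * (w σ * w τ) = ∑ σ, w σ * h σ := fun h =>
      sum_congr rfl fun σ _ => by rw [← mul_sum, ← mul_sum, hw1]; ring
    have hright : ∀ h : S → ℝ, ∑ σ, ∑ τ, h τ * (w σ * w τ) = ∑ σ, w σ * h σ := fun h => by
      rw [sum_comm, ← hleft h]
      exact sum_congr rfl fun σ _ => sum_congr rfl fun τ _ => by ring
    have hone : ∑ σ, ∑ τ, w σ * w τ = 1 := by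
      simpa [hw1] using hleft fun _ => 1
    have hxr : ∑ σ, ∑ τ, x τ ^ 2 * (w σ * w τ) = Y := hright fun τ => x τ ^ 2
    have hαl : ∑ σ, ∑ τ, α σ ^ 2 * (w σ * w τ) = B := hleft fun σ => α σ ^ 2
    have hαr : ∑ σ, ∑ τ, α τ ^ 2 * (w σ * w τ) = B := hright fun τ => α τ ^ 2
    have hstein : n * (Φ ^ 2 - (ε / 2 * F + 2 * ε * G) * Φ)
        ≤ 500 * V ^ 2 * (1 + A g / n ^ 2 + Y + B + B) + D g := by
      have h := sum_le_sum fun σ (_ : σ ∈ univ) => sum_le_sum fun τ (_ : τ ∈ univ) =>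
        stein_pair_le (v' := v') hs hn hcard hε0 hε hv hst hf hxf hf' σ τ (hr σ τ) g
      refine (le_of_eq ?_).trans (h.trans (le_of_eq ?_))
      · simp only [← mul_sum]
        congr 1
        have e : ε / 2 * F + 2 * ε * G = ∑ σ, w σ * ((ε / 2 + 2 * ε * α σ) * f (x σ)) := by
          rw [hF, hG, mul_sum, mul_sum, ← sum_add_distrib]
          exact sum_congr rfl fun σ _ => by ring
        rw [e, sq, ← sub_mul, hΦ, ← sum_sub_distrib, sum_mul_sum]
        exact sum_congr rfl fun σ _ => sum_congr rfl fun τ _ => by ring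
      · simp only [sum_add_distrib]
        congr 1
        have e : 1 + A g / n ^ 2 + Y + B + B = ∑ σ, ∑ τ, (1 + (corr s σ τ / n) ^ 2 + x τ ^ 2
            + α σ ^ 2 + α τ ^ 2) * (w σ * w τ) := by
          simp only [add_mul, sum_add_distrib, one_mul, hone, hAn, hxr, hαl, hαr]
        rw [e]
        simp only [mul_sum]
        exact sum_congr rfl fun σ _ => sum_congr rfl fun τ _ => mul_assoc _ _ _
    have hsecond : Y ≤ 2 + 4 * (A g / n ^ 2) + 8 * B - 2 / n * D' g := by
      have h := sum_le_sum fun σ (_ : σ ∈ univ) => sum_le_sum fun τ (_ : τ ∈ univ) =>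
        fluct_sq_pair_le s hn hcard hε σ τ g
      refine (le_of_eq ?_).trans (h.trans (le_of_eq ?_))
      · exact (hleft fun σ => x σ ^ 2).symm
      · simp only [sum_sub_distrib, ← mul_sum]
        congr 1
        change ∑ σ, ∑ τ, (2 + 4 * (corr s σ τ / n) ^ 2 + 8 * α σ ^ 2) * (w σ * w τ) = _
        simp only [add_mul, sum_add_distrib, mul_assoc, ← mul_sum, hw1, ← hAn, ← hαl]
        simp only [mul_sum, mul_one]
        rw [← mul_sum, hw1, mul_one]
    have hjensen : ∀ h : S → ℝ, (∑ σ, w σ * h σ) ^ 2 ≤ ∑ σ, w σ * h σ ^ 2 := fun h =>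
      Real.pow_arith_mean_le_arith_mean_pow_of_even univ w h (fun σ _ => hw σ) hw1 even_two
    have hBA : B ≤ A g / n ^ 2 := by
      rw [← hAn]
      refine sum_le_sum fun σ _ => ?_
      have h := hjensen fun τ => corr s σ τ / n
      have e : α σ = ∑ τ, w τ * (corr s σ τ / n) := by
        simp only [hα, meanCorr, sum_div, mul_div_assoc]
        rfl
      rw [e]
      refine (mul_le_mul_of_nonneg_left h (hw σ)).trans (le_of_eq ?_)
      rw [mul_sum]
      exact sum_congr rfl fun τ _ => by ring
    have hfs : ∀ y, f y ^ 2 ≤ 9 * V ^ 2 := fun y => by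
      have h := sq_le_sq' (neg_le_of_abs_le (hf y)) (le_of_abs_le (hf y))
      linarith [mul_pow 3 V 2]
    have hF2 : F ^ 2 ≤ 9 * V ^ 2 := (hjensen _).trans <| by
      refine (sum_le_sum fun σ _ => mul_le_mul_of_nonneg_left (hfs _) (hw σ)).trans (le_of_eq ?_)
      rw [← sum_mul, hw1, one_mul]
    have hG2 : G ^ 2 ≤ 9 * V ^ 2 * B := (hjensen _).trans <| by
      rw [hB, mul_sum]
      refine sum_le_sum fun σ _ => ?_
      rw [mul_pow]
      linarith [mul_le_mul_of_nonneg_left (hfs (x σ)) (mul_nonneg (hw σ) (sq_nonneg (α σ)))]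
    have hV2 := sq_nonneg V
    have hB0 : 0 ≤ B := sum_nonneg fun σ _ => mul_nonneg (hw σ) (sq_nonneg _)
    have h1 : n * (ε / 2 * F * Φ) ≤ n * Φ ^ 2 / 4 + 9 * V ^ 2 / 4 := by
      have h2 := mul_le_mul hε hF2 (sq_nonneg F) zero_le_one
      linarith [mul_nonneg hn0.le (sq_nonneg (Φ - ε * F))]
    have h2 : n * (2 * ε * G * Φ) ≤ n * Φ ^ 2 / 4 + 36 * V ^ 2 * B := by
      have h2 := mul_le_mul hε hG2 (sq_nonneg G) zero_le_one
      linarith [mul_nonneg hn0.le (sq_nonneg (Φ - 4 * ε * G))]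
    have h3 := mul_le_mul_of_nonneg_left hsecond hV2
    have h4 := mul_le_mul_of_nonneg_left hBA hV2
    have h5 : n * Φ ^ 2 ≤ V ^ 2 * (3005 + 15072 * (A g / n ^ 2)) + 2 * D g
        - 1000 * V ^ 2 * (2 / n * D' g) := by
      linarith
    have e : V ^ 2 / n * (3005 + 15072 * (A g / n ^ 2)) + 2 / n * D g
        - 2000 * V ^ 2 / n ^ 2 * D' g = (V ^ 2 * (3005 + 15072 * (A g / n ^ 2)) + 2 * D g
        - 1000 * V ^ 2 * (2 / n * D' g)) / n := by
      field_simp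
      ring
    rw [e, le_div_iff₀ hn0]
    linarith
  have hA' : Integrable (fun g => 3005 + 15072 * (A g / n ^ 2)) (gaussPi ι) :=
    (integrable_const _).add ((hAi.div_const _).const_mul _)
  have hsum : Integrable (fun g => V ^ 2 / n * (3005 + 15072 * (A g / n ^ 2)) + 2 / n * D g)
      (gaussPi ι) := (hA'.const_mul _).add (hDi.const_mul _)
  have hall : Integrable (fun g => V ^ 2 / n * (3005 + 15072 * (A g / n ^ 2)) + 2 / n * D g
      - 2000 * V ^ 2 / n ^ 2 * D' g) (gaussPi ι) := hsum.sub (hDi'.const_mul _)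
  refine (integral_mono_of_nonneg (ae_of_all _ fun g => sq_nonneg _) hall
    (ae_of_all _ hpt)).trans (le_of_eq ?_)
  rw [integral_sub hsum (hDi'.const_mul _), integral_add (hA'.const_mul _) (hDi.const_mul _),
    integral_const_mul, integral_const_mul, integral_const_mul, hD0, hD0',
    integral_add (integrable_const _) ((hAi.div_const _).const_mul _), integral_const_mul,
    integral_div, integral_const]
  simp only [probReal_univ, one_smul, mul_zero, add_zero, sub_zero]
  ring

end SmoothCLT

/-! ### Bounded measurable test functions -/

theorem fluct_update {ι S : Type} [Fintype ι] [DecidableEq ι] (s : S → ι → ℝ) (n δ : ℝ)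
    (g : ι → ℝ) (p : ι) (σ : S) (x : ℝ) :
    fluct s n δ (Function.update g p x) σ
      = s σ p / n * x + (∑ q ∈ univ.erase p, g q * s σ q / n - δ) := by
  rw [fluct, energy, ← add_sum_erase univ _ (mem_univ p), Function.update_self,
    sum_congr rfl fun q hq => by rw [Function.update_of_ne (ne_of_mem_erase hq)], add_div, sum_div]
  ring

/-- The energy of a configuration has an absolutely continuous law. -/
theorem ae_fluct {ι S : Type} [Fintype ι] [Nonempty ι] {s : S → ι → ℝ}
    (hs : ∀ σ p, s σ p * s σ p = 1) {n : ℝ} (hn : n ≠ 0) (δ : ℝ) (σ : S) {P : ℝ → Prop}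
    (hP : ∀ᵐ t, P t) : ∀ᵐ g ∂gaussPi ι, P (fluct s n δ g σ) := by
  classical
  obtain ⟨p⟩ := ‹Nonempty ι›
  have hc : s σ p / n ≠ 0 := div_ne_zero (fun h => by simpa [h] using hs σ p) hn
  obtain ⟨T, hT, hTm, hT0⟩ := exists_measurable_superset_of_null (ae_iff.1 hP)
  have hq : ∀ b, ∀ᵐ x ∂gaussianReal 0 1, s σ p / n * x + b ∉ T := fun b => by
    refine (gaussianReal_absolutelyContinuous 0 one_ne_zero).ae_le (ae_iff.2 ?_)
    have e : {x : ℝ | ¬(s σ p / n * x + b ∉ T)}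
        = (fun x => s σ p / n * x) ⁻¹' ((fun y => y + b) ⁻¹' T) := by
      ext x; simp
    rw [e, Real.volume_preimage_mul_left hc, measure_preimage_add_right, hT0, mul_zero]
  have hm : MeasurableSet {g : ι → ℝ | fluct s n δ g σ ∉ T} := by
    exact (measurable_fluct s n δ σ) hTm.compl
  have hgT : ∀ᵐ g ∂gaussPi ι, fluct s n δ g σ ∉ T := by
    rw [← (measurePreserving_update p).map_eq,
      ae_map_iff (measurePreserving_update p).measurable.aemeasurable hm]
    refine (Measure.ae_prod_iff_ae_ae ((measurePreserving_update p).measurable hm)).2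
      (ae_of_all _ fun g => ?_)
    simpa only [Set.mem_ofPred_eq, fluct_update] using hq _
  filter_upwards [hgT] with g hg
  by_contra h
  exact hg (hT h)

/-- Bounded measurable functions are almost everywhere limits of uniformly bounded smooth
functions. -/
theorem exists_smooth_approx {u : ℝ → ℝ} (hu : Measurable u) {M : ℝ} (hM : ∀ x, |u x| ≤ M) :
    ∃ (w w' : ℕ → ℝ → ℝ) (C : ℕ → ℝ), (∀ k x, HasDerivAt (w k) (w' k x) x) ∧
      (∀ k, Measurable (w' k)) ∧ (∀ k x, |w k x| ≤ M) ∧ (∀ k x, |w' k x| ≤ C k) ∧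
      ∀ᵐ x, Filter.Tendsto (fun k => w k x) Filter.atTop (nhds (u x)) := by
  have hloc : LocallyIntegrable u volume := fun x =>
    ⟨Set.Icc (x - 1) (x + 1), Icc_mem_nhds (by linarith) (by linarith),
      Measure.integrableOn_of_bounded (M := M) measure_Icc_lt_top.ne hu.aestronglyMeasurable
        (ae_of_all _ hM)⟩
  let φ : ℕ → ContDiffBump (0 : ℝ) := fun k =>
    ⟨1 / ((k : ℝ) + 1), 2 * (1 / ((k : ℝ) + 1)), by positivity, by
      have : 0 < 1 / ((k : ℝ) + 1) := by positivity
      linarith⟩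
  have hbound : ∀ ψ : ℝ → ℝ, Integrable ψ → ∀ x,
      |convolution ψ u (ContinuousLinearMap.lsmul ℝ ℝ) volume x| ≤ (∫ t, |ψ t|) * M := by
    intro ψ hψ x
    rw [convolution_lsmul, ← integral_mul_const]
    refine norm_integral_le_of_norm_le (f := fun t => ψ t • u (x - t)) (hψ.abs.mul_const M)
      (ae_of_all _ fun t => ?_)
    rw [norm_smul]
    exact mul_le_mul_of_nonneg_left (hM _) (abs_nonneg _)
  have hd : ∀ k, ContDiff ℝ 1 ((φ k).normed volume) := fun k => (φ k).contDiff_normed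
  have hder : ∀ k x, HasDerivAt
      (convolution ((φ k).normed volume) u (ContinuousLinearMap.lsmul ℝ ℝ) volume)
      (convolution (deriv ((φ k).normed volume)) u (ContinuousLinearMap.lsmul ℝ ℝ) volume x) x :=
    fun k x => (φ k).hasCompactSupport_normed.hasDerivAt_convolution_left _ (hd k) hloc x
  refine ⟨fun k => convolution ((φ k).normed volume) u (ContinuousLinearMap.lsmul ℝ ℝ) volume,
    fun k => convolution (deriv ((φ k).normed volume)) u (ContinuousLinearMap.lsmul ℝ ℝ) volume,
    fun k => (∫ t, |deriv ((φ k).normed volume) t|) * M, hder, fun k => ?_, fun k x => ?_,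
    fun k => hbound _ ?_, ?_⟩
  · have h := measurable_deriv (convolution ((φ k).normed volume) u
      (ContinuousLinearMap.lsmul ℝ ℝ) volume)
    rwa [funext fun x => (hder k x).deriv] at h
  · have h := hbound _ (φ k).integrable_normed x
    simpa only [abs_of_nonneg ((φ k).nonneg_normed _), (φ k).integral_normed, one_mul] using h
  · exact ((hd k).continuous_deriv le_rfl).integrable_of_hasCompactSupport
      (φ k).hasCompactSupport_normed.deriv
  · refine ContDiffBump.ae_convolution_tendsto_right_of_locallyIntegrable (K := 2) ?_
      (Filter.Eventually.of_forall fun k => le_rfl) hloc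
    have h := (tendsto_one_div_add_atTop_nhds_zero_nat (𝕜 := ℝ)).const_mul 2
    rwa [mul_zero] at h

theorem gaussDens_zero_half (t : ℝ) : gaussDens 0 (1 / 2) t = (√π)⁻¹ * exp (-t ^ 2) := by
  rw [gaussDens, ← Real.sqrt_mul (by positivity)]
  congr 2 <;> ring_nf

theorem integrable_gaussDens_zero_half : Integrable (gaussDens 0 (1 / 2)) := by
  simpa only [← gaussDens_zero_half] using integrable_exp_neg_sq.const_mul (√π)⁻¹

theorem integral_gaussDens_zero_half : ∫ t, gaussDens 0 (1 / 2) t = 1 := by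
  have h := integral_gaussian 1
  simp only [neg_mul, one_mul, div_one] at h
  simp only [gaussDens_zero_half]
  rw [integral_const_mul, h, inv_mul_cancel₀ (by positivity)]

theorem gaussDens_nonneg (t : ℝ) : 0 ≤ gaussDens 0 (1 / 2) t := by
  rw [gaussDens_zero_half]; positivity

theorem abs_integral_mul_gaussDens_le {u : ℝ → ℝ} {M : ℝ} (hM : ∀ x, |u x| ≤ M) :
    |∫ t, u t * gaussDens 0 (1 / 2) t| ≤ M := by
  have h := norm_integral_le_of_norm_le (integrable_gaussDens_zero_half.const_mul M)
    (f := fun t => u t * gaussDens 0 (1 / 2) t) (ae_of_all _ fun t => by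
      rw [norm_mul, Real.norm_of_nonneg (gaussDens_nonneg t)]
      exact mul_le_mul_of_nonneg_right (hM t) (gaussDens_nonneg t))
  rwa [integral_const_mul, integral_gaussDens_zero_half, mul_one] at h

/-- Second moment of the difference between quenched averages and the Gaussian average. -/
theorem integral_sq_average_sub_le {ι S : Type} [Fintype ι] [Fintype S] [Nonempty S]
    [DecidableEq ι] {s : S → ι → ℝ} (hs : ∀ σ p, s σ p * s σ p = 1) {n ε M : ℝ} (hn : 2 ≤ n)
    (hcard : 2 * (Fintype.card ι : ℝ) = n ^ 2 - n) (hε0 : 0 ≤ ε) (hε : n * ε ^ 2 ≤ 1)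
    {u : ℝ → ℝ} (hu : Measurable u) (hM : ∀ x, |u x| ≤ M) :
    ∫ g, (∑ σ, wt s ε g σ * u (fluct s n (n * ε / 2) g σ)
        - ∫ t, u t * gaussDens 0 (1 / 2) t) ^ 2 ∂gaussPi ι
      ≤ (2 * M) ^ 2 / n * (3005 + 15072 *
        (∫ g, ∑ σ, ∑ τ, wt s ε g σ * wt s ε g τ * corr s σ τ ^ 2 ∂gaussPi ι) / n ^ 2) := by
  have hn0 : 0 < n := by linarith
  have : Nonempty ι := Fintype.card_pos_iff.1 (by
    have : (0 : ℝ) < Fintype.card ι := by nlinarith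
    exact_mod_cast this)
  obtain ⟨w, w', C, hwd, hwm, hw, hw', hlim⟩ := exists_smooth_approx hu hM
  have hwc : ∀ k, Continuous (w k) := fun k =>
    continuous_iff_continuousAt.2 fun x => (hwd k x).continuousAt
  set m : ℕ → ℝ := fun k => ∫ t, w k t * gaussDens 0 (1 / 2) t
  have hm : ∀ k, |m k| ≤ M := fun k => abs_integral_mul_gaussDens_le (hw k)
  have hmlim : Filter.Tendsto m Filter.atTop (nhds (∫ t, u t * gaussDens 0 (1 / 2) t)) := by
    refine tendsto_integral_of_dominated_convergence (fun t => M * gaussDens 0 (1 / 2) t)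
      (fun k => ((hwc k).aestronglyMeasurable).mul
        integrable_gaussDens_zero_half.aestronglyMeasurable)
      (integrable_gaussDens_zero_half.const_mul M) (fun k => ae_of_all _ fun t => ?_) ?_
    · rw [norm_mul, Real.norm_of_nonneg (gaussDens_nonneg t)]
      exact mul_le_mul_of_nonneg_right (hw k t) (gaussDens_nonneg t)
    · filter_upwards [hlim] with t ht using ht.mul_const _
  have havg : ∀ k g, ∑ σ, wt s ε g σ * (w k (fluct s n (n * ε / 2) g σ) - m k)
      = ∑ σ, wt s ε g σ * w k (fluct s n (n * ε / 2) g σ) - m k := fun k g => by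
    simp only [mul_sub, sum_sub_distrib, ← sum_mul, sum_wt, one_mul]
  have hsmooth : ∀ k, ∫ g, (∑ σ, wt s ε g σ * w k (fluct s n (n * ε / 2) g σ) - m k) ^ 2 ∂gaussPi ι
      ≤ (2 * M) ^ 2 / n * (3005 + 15072 *
        (∫ g, ∑ σ, ∑ τ, wt s ε g σ * wt s ε g τ * corr s σ τ ^ 2 ∂gaussPi ι) / n ^ 2) := fun k => by
    simp only [← havg]
    refine integral_sq_average_le (v := fun t => w k t - m k) hs hn hcard hε0 hε
      (fun x => (hwd k x).sub_const _) (hwm k)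
      (fun x => (abs_sub _ _).trans (by linarith [hw k x, hm k])) (hw' k) ?_
    have hi : Integrable fun t => w k t * exp (-t ^ 2) :=
      integrable_exp_neg_sq.bdd_mul (hwc k).aestronglyMeasurable (ae_of_all _ (hw k))
    have e : m k = (√π)⁻¹ * ∫ t, w k t * exp (-t ^ 2) := by
      rw [← integral_const_mul]
      exact integral_congr_ae (ae_of_all _ fun t => by simp only [gaussDens_zero_half]; ring)
    have h := integral_gaussian 1
    simp only [neg_mul, one_mul, div_one] at h
    simp only [sub_mul]
    rw [integral_sub hi (integrable_exp_neg_sq.const_mul _), integral_const_mul, h, e]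
    field_simp
    ring
  refine le_of_tendsto (tendsto_integral_of_dominated_convergence (fun _ => (2 * M) ^ 2)
    (fun k => ?_) (integrable_const _) (fun k => ae_of_all _ fun g => ?_) ?_)
    (Filter.Eventually.of_forall hsmooth)
  · have := fun σ => (hwc k).measurable.comp (measurable_fluct s n (n * ε / 2) σ)
    have h : Measurable fun g => ∑ σ, wt s ε g σ * w k (fluct s n (n * ε / 2) g σ) - m k :=
      (Finset.measurable_fun_sum _ fun σ _ => (measurable_wt s ε σ).mul (this σ)).sub_const _
    exact (h.pow_const 2).aestronglyMeasurable
  · have h : |∑ σ, wt s ε g σ * w k (fluct s n (n * ε / 2) g σ)| ≤ M := by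
      refine (abs_sum_le_sum_abs _ _).trans ?_
      rw [← one_mul M, ← sum_wt s ε g, sum_mul]
      refine sum_le_sum fun σ _ => ?_
      rw [abs_mul, abs_of_nonneg (wt_nonneg ..)]
      exact mul_le_mul_of_nonneg_left (hw k _) (wt_nonneg ..)
    rw [norm_pow]
    exact pow_le_pow_left₀ (norm_nonneg _) ((abs_sub _ _).trans (by linarith [hm k])) 2
  · filter_upwards [ae_all_iff.2 fun σ => ae_fluct hs hn0.ne' (n * ε / 2) σ hlim] with g hg
    exact ((tendsto_finsetSum _ fun σ _ => (hg σ).const_mul _).sub hmlim).pow 2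

theorem ham_zero_eq {N : ℕ} (β : ℝ) (G : Disorder N) (σ : Config N) :
    ham β 0 G σ = β / √N * energy (skCoeff N) G σ := by
  rw [ham, energy, zero_mul, add_zero]
  simp only [skCoeff, mul_assoc]

theorem qavg_zero_eq {N : ℕ} (β : ℝ) (G : Disorder N) (f : Config N → ℝ) :
    qavg β 0 G f = ∑ σ, wt (skCoeff N) (β / √N) G σ * f σ := by
  simp only [qavg, gibbs, Zpart, wt, gibbsWt, ham_zero_eq, mul_comm (f _)]

/-- Theorem 1.6 (CLT for the Hamiltonian at zero external field, `β < 1`). -/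
theorem hamiltonian_clt (β : ℝ) (hβ0 : 0 < β) (hβ1 : β < 1) :
    ∃ C : ℝ, 0 < C ∧ ∀ (N : ℕ), 2 ≤ N →
      ∀ u : ℝ → ℝ, Measurable u → ∀ M : ℝ, (∀ x, |u x| ≤ M) →
        ∫ G, (qavg β 0 G
              (fun σ => u ((1 / (N : ℝ))
                  * ∑ p : Pairs N, G p * spin (σ p.1.1) * spin (σ p.1.2)
                - Real.sqrt N * β / 2))
            - ∫ t, u t * gaussDens 0 (1 / 2) t) ^ 2 ∂(μdis N)
        ≤ C * M ^ 2 / N := by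
  obtain ⟨K, hK0, hK⟩ := exists_integral_corr_sq_le hβ0 hβ1
  refine ⟨4 * (3005 + 15072 * K), by positivity, fun N hN u hu M hM => ?_⟩
  have hn : (2 : ℝ) ≤ N := by exact_mod_cast hN
  have hn0 : (0 : ℝ) < N := by linarith
  have hsq : √N * √N = (N : ℝ) := Real.mul_self_sqrt hn0.le
  have hs0 : 0 < √(N : ℝ) := Real.sqrt_pos.2 hn0
  have hε : (N : ℝ) * (β / √N) ^ 2 ≤ 1 := by
    rw [div_pow, sq √(N : ℝ), hsq, mul_div_cancel₀ _ hn0.ne']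
    nlinarith
  have hδ : (N : ℝ) * (β / √N) = √N * β := by
    rw [← mul_div_assoc, div_eq_iff hs0.ne', mul_right_comm, hsq]
  have hH : ∀ (G : Disorder N) (σ : Config N),
      (1 / (N : ℝ)) * ∑ p : Pairs N, G p * spin (σ p.1.1) * spin (σ p.1.2) - Real.sqrt N * β / 2
        = fluct (skCoeff N) N (N * (β / √N) / 2) G σ := fun G σ => by
    rw [hδ, fluct, energy, one_div_mul_eq_div]
    simp only [skCoeff, mul_assoc]
  simp only [hH, qavg_zero_eq]
  refine (integral_sq_average_sub_le (skCoeff_mul_self N) hn (two_mul_card_pairs N) (by positivity)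
    hε hu hM).trans ?_
  have h := (div_le_iff₀ (by positivity : (0 : ℝ) < (N : ℝ) ^ 2)).2 (hK N hN)
  have h' := mul_le_mul_of_nonneg_left h (by norm_num : (0 : ℝ) ≤ 15072)
  rw [← mul_div_assoc] at h'
  calc _ ≤ (2 * M) ^ 2 / N * (3005 + 15072 * K) := by gcongr
    _ = 4 * (3005 + 15072 * K) * M ^ 2 / N := by ring

end SK
end

section
/- Fix a, b ∈ ℝ, σ² > 0, and a bounded measurable function u : ℝ → ℝ. Then there exists a function f : ℝ² → ℝ, absolutely continuous in each variable, such that for all x, μ ∈ ℝ, (∂f/∂x)(x,μ) - ( (x-μ)/σ² - a tanh(ax+b) ) f(x,μ) = u(x) - ∫_ℝ u(t) ψ_{a,b,μ,σ²}(t) dt; moreover f can be chosen so that for some constant C depending only on a and σ, the quantities |f|, |∂f/∂x|, and |∂f/∂μ| are all uniformly bounded by C ‖u‖_∞. -/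
open MeasureTheory ProbabilityTheory Real Finset

namespace SK

/-- Unnormalized density of the mixture of two Gaussians. -/
noncomputable def mixWeight (a b v m t : ℝ) : ℝ :=
  Real.cosh (a * t + b) * Real.exp (-(t - m) ^ 2 / (2 * v))

/-- Gaussian envelope with an exponential correction. -/
noncomputable def envelope (c v s : ℝ) : ℝ := Real.exp (c * |s| - s ^ 2 / (2 * v))

theorem mixWeight_pos (a b v m t : ℝ) : 0 < mixWeight a b v m t :=
  mul_pos (Real.cosh_pos _) (Real.exp_pos _)

theorem continuous_mixWeight (a b v m : ℝ) : Continuous (mixWeight a b v m) := by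
  unfold mixWeight
  fun_prop

theorem envelope_pos (c v s : ℝ) : 0 < envelope c v s := Real.exp_pos _

theorem integrable_envelope {v : ℝ} (hv : 0 < v) (c : ℝ) : Integrable (envelope c v) := by
  have h := (integrable_exp_neg_mul_sq (b := 1 / (4 * v)) (by positivity)).const_mul
    (Real.exp (c ^ 2 * v))
  refine h.mono' (by unfold envelope; fun_prop) (Filter.Eventually.of_forall fun s => ?_)
  rw [Real.norm_of_nonneg (envelope_pos _ _ _).le, envelope, ← Real.exp_add, Real.exp_le_exp]
  have h1 : c ^ 2 * v + -(1 / (4 * v)) * s ^ 2 - (c * |s| - s ^ 2 / (2 * v))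
      = (2 * c * v - |s|) ^ 2 / (4 * v) := by
    rw [← sq_abs s]
    field_simp
    ring
  have h2 : 0 ≤ (2 * c * v - |s|) ^ 2 / (4 * v) := by positivity
  linarith

theorem integral_envelope_nonneg (c v : ℝ) : 0 ≤ ∫ s, envelope c v s :=
  integral_nonneg fun s => (envelope_pos c v s).le

theorem abs_mul_envelope_le (c v s : ℝ) : |s| * envelope c v s ≤ envelope (c + 1) v s := by
  have h : envelope (c + 1) v s = Real.exp |s| * envelope c v s := by
    rw [envelope, envelope, ← Real.exp_add]
    ring_nf
  rw [h]
  exact mul_le_mul_of_nonneg_right (by linarith [Real.add_one_le_exp |s|])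
    (envelope_pos _ _ _).le

theorem cosh_add_le_cosh_mul_exp_abs (p q : ℝ) :
    Real.cosh (p + q) ≤ Real.cosh p * Real.exp |q| := by
  rw [Real.cosh_eq, Real.cosh_eq, neg_add, Real.exp_add, Real.exp_add]
  have h1 : Real.exp q ≤ Real.exp |q| := Real.exp_le_exp.2 (le_abs_self q)
  have h2 : Real.exp (-q) ≤ Real.exp |q| := Real.exp_le_exp.2 (neg_le_abs q)
  nlinarith [mul_le_mul_of_nonneg_left h1 (Real.exp_pos p).le,
    mul_le_mul_of_nonneg_left h2 (Real.exp_pos (-p)).le]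

theorem cosh_affine_le (a b x t : ℝ) :
    Real.cosh (a * t + b) ≤ Real.cosh (a * x + b) * Real.exp (|a| * |t - x|) := by
  have h := cosh_add_le_cosh_mul_exp_abs (a * x + b) (a * (t - x))
  rw [abs_mul] at h
  convert h using 2
  ring

/-- Tail comparison: moving from `x` away from `m`, the weight decays at least like the envelope
with an additional exponential factor. -/
theorem mixWeight_le {v : ℝ} (hv : 0 < v) (a b : ℝ) {m x t : ℝ} (h : 0 ≤ (t - x) * (x - m)) :
    mixWeight a b v m t ≤ mixWeight a b v m x *
      (envelope |a| v (t - x) * Real.exp (-(|x - m| / v) * |t - x|)) := by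
  have h1 : |t - x| * |x - m| = (t - x) * (x - m) := by rw [← abs_mul, abs_of_nonneg h]
  have h2 : mixWeight a b v m x *
      (envelope |a| v (t - x) * Real.exp (-(|x - m| / v) * |t - x|)) =
      (Real.cosh (a * x + b) * Real.exp (|a| * |t - x|)) *
        Real.exp (-(t - m) ^ 2 / (2 * v)) := by
    rw [mixWeight, envelope, mul_assoc, mul_assoc, ← Real.exp_add, ← Real.exp_add,
      ← Real.exp_add]
    congr 2
    have h3 : -(|x - m| / v) * |t - x| = -((t - x) * (x - m)) / v := by
      rw [← h1]; ring
    rw [h3]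
    field_simp
    ring
  rw [h2]
  exact mul_le_mul_of_nonneg_right (cosh_affine_le a b x t) (Real.exp_pos _).le

theorem mixWeight_le_envelope {v : ℝ} (hv : 0 < v) (a b m t : ℝ) :
    mixWeight a b v m t ≤ Real.cosh (a * m + b) * envelope |a| v (t - m) := by
  have h := mixWeight_le hv a b (m := m) (x := m) (t := t) (by simp)
  simpa [mixWeight] using h

theorem integrable_mul_mixWeight {v : ℝ} (hv : 0 < v) (a b m : ℝ) {g : ℝ → ℝ}
    (hg : Measurable g) {K : ℝ} (hK : ∀ t, |g t| ≤ K) :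
    Integrable fun t => g t * mixWeight a b v m t := by
  refine ((((integrable_envelope hv |a|).comp_sub_right m).const_mul
    (Real.cosh (a * m + b))).const_mul K).mono'
    (hg.mul (continuous_mixWeight a b v m).measurable).aestronglyMeasurable
    (Filter.Eventually.of_forall fun t => ?_)
  rw [norm_mul, Real.norm_eq_abs, Real.norm_of_nonneg (mixWeight_pos _ _ _ _ _).le]
  exact mul_le_mul (hK t) (mixWeight_le_envelope hv a b m t) (mixWeight_pos _ _ _ _ _).le
    ((abs_nonneg _).trans (hK t))

theorem hasDerivAt_mixWeight_mean (a b v m t : ℝ) :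
    HasDerivAt (fun m => mixWeight a b v m t) ((t - m) / v * mixWeight a b v m t) m := by
  have h := (((((hasDerivAt_id' m).const_sub t).fun_pow 2).fun_neg.div_const (2 * v)).exp).const_mul
    (Real.cosh (a * t + b))
  refine h.congr_deriv ?_
  simp only [mixWeight]
  by_cases hv : v = 0
  · simp [hv]
  · field_simp
    simp [mul_comm]

theorem hasDerivAt_integral_mixWeight {v : ℝ} (hv : 0 < v) (a b m : ℝ) {g : ℝ → ℝ}
    (hg : Measurable g) {K : ℝ} (hK : ∀ t, |g t| ≤ K) :
    Integrable (fun t => g t * ((t - m) / v * mixWeight a b v m t)) ∧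
    HasDerivAt (fun m => ∫ t, g t * mixWeight a b v m t)
      (∫ t, g t * ((t - m) / v * mixWeight a b v m t)) m := by
  have hK0 : 0 ≤ K := (abs_nonneg _).trans (hK 0)
  refine hasDerivAt_integral_of_dominated_loc_of_deriv_le (μ := volume)
    (F := fun m t => g t * mixWeight a b v m t)
    (F' := fun m t => g t * ((t - m) / v * mixWeight a b v m t))
    (bound := fun t => K * (1 / v * (Real.cosh (a * m + b) *
      envelope (|a| + 1 / v + 1) v (t - m))))
    (Metric.ball_mem_nhds m one_pos)
    (Filter.Eventually.of_forall fun n =>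
      (hg.mul (continuous_mixWeight a b v n).measurable).aestronglyMeasurable)
    (integrable_mul_mixWeight hv a b m hg hK)
    (hg.mul (((measurable_id.sub_const m).div_const v).mul
      (continuous_mixWeight a b v m).measurable)).aestronglyMeasurable
    (Filter.Eventually.of_forall fun t n hn => ?_)
    (((((integrable_envelope hv _).comp_sub_right m).const_mul _).const_mul _).const_mul _)
    (Filter.Eventually.of_forall fun t n _ =>
      (hasDerivAt_mixWeight_mean a b v n t).const_mul (g t))
  rw [Metric.mem_ball, Real.dist_eq] at hn
  have h1 : |t - n| ≤ Real.exp |t - m| := by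
    have h := abs_sub_le t m n
    rw [abs_sub_comm m n] at h
    linarith [Real.add_one_le_exp |t - m|]
  have h2 : Real.exp (-(t - n) ^ 2 / (2 * v)) ≤
      Real.exp (|t - m| / v - (t - m) ^ 2 / (2 * v)) := by
    rw [Real.exp_le_exp]
    have h3 : (t - m) * (n - m) ≤ |t - m| := by
      refine (le_abs_self _).trans ?_
      rw [abs_mul]
      exact mul_le_of_le_one_right (abs_nonneg _) hn.le
    have h4 : |t - m| / v - (t - m) ^ 2 / (2 * v) - -(t - n) ^ 2 / (2 * v) =
        (2 * (|t - m| - (t - m) * (n - m)) + (n - m) ^ 2) / (2 * v) := by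
      field_simp
      ring
    have h5 : 0 ≤ (2 * (|t - m| - (t - m) * (n - m)) + (n - m) ^ 2) / (2 * v) :=
      div_nonneg (by nlinarith [sq_nonneg (n - m)]) (by positivity)
    linarith
  have h6 : |t - n| * mixWeight a b v n t ≤ Real.cosh (a * m + b) *
      envelope (|a| + 1 / v + 1) v (t - m) := by
    calc |t - n| * mixWeight a b v n t
        ≤ Real.exp |t - m| * ((Real.cosh (a * m + b) * Real.exp (|a| * |t - m|)) *
            Real.exp (|t - m| / v - (t - m) ^ 2 / (2 * v))) := by
          have := (Real.cosh_pos (a * m + b)).le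
          exact mul_le_mul h1 (mul_le_mul (cosh_affine_le a b m t) h2 (Real.exp_pos _).le
            (by positivity)) (mixWeight_pos _ _ _ _ _).le (Real.exp_pos _).le
      _ = Real.cosh (a * m + b) * (Real.exp |t - m| * Real.exp (|a| * |t - m|) *
            Real.exp (|t - m| / v - (t - m) ^ 2 / (2 * v))) := by ring
      _ = _ := by
          rw [envelope, ← Real.exp_add, ← Real.exp_add]
          ring_nf
  rw [norm_mul, norm_mul, norm_div, Real.norm_eq_abs, Real.norm_eq_abs, Real.norm_eq_abs,
    Real.norm_of_nonneg (mixWeight_pos _ _ _ _ _).le, abs_of_pos hv]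
  refine mul_le_mul (hK t) ?_ (by have := (mixWeight_pos a b v n t).le; positivity) hK0
  calc |t - n| / v * mixWeight a b v n t = 1 / v * (|t - n| * mixWeight a b v n t) := by ring
    _ ≤ _ := mul_le_mul_of_nonneg_left h6 (by positivity)

theorem integral_mixWeight {v : ℝ} (hv : 0 < v) (a b m : ℝ) :
    ∫ t, mixWeight a b v m t =
      Real.sqrt (2 * π) * Real.sqrt v * Real.cosh (a * m + b) * Real.exp (a ^ 2 * v / 2) := by
  have key (c : ℝ) : Integrable (fun t => Real.exp (-(1 / (2 * v)) * (t - (m + c * v)) ^ 2)) ∧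
      ∫ t, Real.exp (-(1 / (2 * v)) * (t - (m + c * v)) ^ 2) =
        Real.sqrt (2 * π) * Real.sqrt v := by
    refine ⟨(integrable_exp_neg_mul_sq (b := 1 / (2 * v))
      (by positivity)).comp_sub_right (m + c * v), ?_⟩
    rw [integral_sub_right_eq_self (fun t => Real.exp (-(1 / (2 * v)) * t ^ 2)),
      integral_gaussian, ← Real.sqrt_mul (by positivity)]
    congr 1
    field_simp
  have hW (t : ℝ) : mixWeight a b v m t =
      Real.exp (a * m + b + a ^ 2 * v / 2) / 2 *
        Real.exp (-(1 / (2 * v)) * (t - (m + a * v)) ^ 2) +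
      Real.exp (-(a * m + b) + a ^ 2 * v / 2) / 2 *
        Real.exp (-(1 / (2 * v)) * (t - (m + -a * v)) ^ 2) := by
    rw [mixWeight, Real.cosh_eq, div_mul_eq_mul_div, add_mul, add_div, div_mul_eq_mul_div,
      div_mul_eq_mul_div, ← Real.exp_add, ← Real.exp_add, ← Real.exp_add, ← Real.exp_add]
    congr 3 <;>
    · field_simp
      ring
  simp_rw [hW]
  rw [integral_add ((key a).1.const_mul _) ((key (-a)).1.const_mul _), integral_const_mul,
    integral_const_mul, (key a).2, (key (-a)).2, Real.cosh_eq, Real.exp_add (a * m + b) (a ^ 2 * v / 2),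
    Real.exp_add (-(a * m + b)) (a ^ 2 * v / 2)]
  ring

theorem integral_mixWeight_pos {v : ℝ} (hv : 0 < v) (a b m : ℝ) :
    0 < ∫ t, mixWeight a b v m t := by
  rw [integral_mixWeight hv]
  have := Real.cosh_pos (a * m + b)
  positivity

theorem mixDens_eq {v : ℝ} (hv : 0 < v) (a b m t : ℝ) :
    mixDens a b m v t = mixWeight a b v m t / ∫ s, mixWeight a b v m s := by
  rw [integral_mixWeight hv]
  rfl

theorem abs_integral_deriv_mixWeight_le {v : ℝ} (hv : 0 < v) (a b m : ℝ) {g : ℝ → ℝ}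
    {K : ℝ} (hK : ∀ t, |g t| ≤ K) :
    |∫ t, g t * ((t - m) / v * mixWeight a b v m t)| ≤
      K * ((∫ s, envelope (|a| + 1) v s) / (v * (Real.sqrt (2 * π) * Real.sqrt v))) *
        ∫ t, mixWeight a b v m t := by
  have hK0 : 0 ≤ K := (abs_nonneg _).trans (hK 0)
  have hc := Real.cosh_pos (a * m + b)
  have h1 : ‖∫ t, g t * ((t - m) / v * mixWeight a b v m t)‖ ≤
      ∫ t, K / v * Real.cosh (a * m + b) * envelope (|a| + 1) v (t - m) := by
    refine norm_integral_le_of_norm_le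
      (((integrable_envelope hv _).comp_sub_right m).const_mul _)
      (Filter.Eventually.of_forall fun t => ?_)
    rw [norm_mul, norm_mul, norm_div, Real.norm_eq_abs, Real.norm_eq_abs, Real.norm_eq_abs,
      Real.norm_of_nonneg (mixWeight_pos _ _ _ _ _).le, abs_of_pos hv]
    calc |g t| * (|t - m| / v * mixWeight a b v m t)
        ≤ K * (|t - m| / v * (Real.cosh (a * m + b) * envelope |a| v (t - m))) := by
          have := (mixWeight_pos a b v m t).le
          have := mixWeight_le_envelope hv a b m t
          gcongr
          exact hK t
      _ = K / v * Real.cosh (a * m + b) * (|t - m| * envelope |a| v (t - m)) := by ring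
      _ ≤ _ := mul_le_mul_of_nonneg_left (abs_mul_envelope_le _ _ _) (by positivity)
  rw [integral_const_mul, integral_sub_right_eq_self (envelope (|a| + 1) v)] at h1
  refine h1.trans ?_
  have h0 := integral_envelope_nonneg (|a| + 1) v
  rw [integral_mixWeight hv]
  have h2 : K * ((∫ s, envelope (|a| + 1) v s) / (v * (Real.sqrt (2 * π) * Real.sqrt v))) *
      (Real.sqrt (2 * π) * Real.sqrt v * Real.cosh (a * m + b) * Real.exp (a ^ 2 * v / 2)) =
      K / v * Real.cosh (a * m + b) * (∫ s, envelope (|a| + 1) v s) *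
        Real.exp (a ^ 2 * v / 2) := by
    have : 0 < Real.sqrt (2 * π) := by positivity
    have : 0 < Real.sqrt v := by positivity
    field_simp
  rw [h2]
  exact le_mul_of_one_le_right (by positivity) (Real.one_le_exp (by positivity))

/-- Mean of `u` under the mixture: value and derivative bounds. -/
theorem hasDerivAt_mixture_mean {v : ℝ} (hv : 0 < v) (a b m : ℝ) {u : ℝ → ℝ}
    (hu : Measurable u) {M : ℝ} (hM : ∀ t, |u t| ≤ M) :
    |∫ t, u t * mixDens a b m v t| ≤ M ∧
    ∃ e, HasDerivAt (fun m => ∫ t, u t * mixDens a b m v t) e m ∧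
      |e| ≤ M * (2 * ((∫ s, envelope (|a| + 1) v s) /
        (v * (Real.sqrt (2 * π) * Real.sqrt v)))) := by
  have hM0 : 0 ≤ M := (abs_nonneg _).trans (hM 0)
  set B := (∫ s, envelope (|a| + 1) v s) / (v * (Real.sqrt (2 * π) * Real.sqrt v))
  have hrep (n : ℝ) : ∫ t, u t * mixDens a b n v t =
      (∫ t, u t * mixWeight a b v n t) / ∫ t, 1 * mixWeight a b v n t := by
    simp_rw [one_mul, mixDens_eq hv, ← mul_div_assoc]
    rw [integral_div]
  have hZ := integral_mixWeight_pos hv a b m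
  have hbd : |∫ t, u t * mixWeight a b v m t| ≤ M * ∫ t, mixWeight a b v m t := by
    rw [← integral_const_mul, ← Real.norm_eq_abs]
    refine norm_integral_le_of_norm_le
      (integrable_mul_mixWeight hv a b m (g := fun _ => M) measurable_const
        (fun _ => (abs_of_nonneg hM0).le))
      (Filter.Eventually.of_forall fun t => ?_)
    rw [norm_mul, Real.norm_eq_abs, Real.norm_of_nonneg (mixWeight_pos _ _ _ _ _).le]
    exact mul_le_mul_of_nonneg_right (hM t) (mixWeight_pos _ _ _ _ _).le
  have h1 := (hasDerivAt_integral_mixWeight hv a b m hu hM).2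
  have h2 := (hasDerivAt_integral_mixWeight hv a b m (g := fun _ => (1 : ℝ)) measurable_const
    (K := 1) (by simp)).2
  have b1 := abs_integral_deriv_mixWeight_le hv a b m hM
  have b2 := abs_integral_deriv_mixWeight_le hv a b m (g := fun _ => (1 : ℝ)) (K := 1) (by simp)
  have hZ' : (∫ t, 1 * mixWeight a b v m t) = ∫ t, mixWeight a b v m t := by simp
  have h3 := h1.fun_div h2 (by rw [hZ']; exact hZ.ne')
  simp_rw [hrep]
  rw [hZ'] at h3 ⊢
  refine ⟨?_, _, h3, ?_⟩
  · rw [abs_div, abs_of_pos hZ]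
    exact div_le_of_le_mul₀ hZ.le hM0 hbd
  · rw [abs_div, abs_of_pos (pow_pos hZ 2), div_le_iff₀ (pow_pos hZ 2)]
    refine (abs_sub _ _).trans ?_
    rw [abs_mul, abs_mul, abs_of_pos hZ]
    have e1 := mul_le_mul_of_nonneg_right b1 hZ.le
    have e2 := mul_le_mul hbd b2 (abs_nonneg _) (by positivity)
    refine (add_le_add e1 e2).trans (le_of_eq ?_)
    ring

theorem integrable_integral_mul_exp_neg_abs {c : ℝ} (hc : 0 ≤ c) :
    Integrable (fun s : ℝ => c * Real.exp (-c * |s|)) ∧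
      ∫ s : ℝ, c * Real.exp (-c * |s|) ≤ 2 := by
  rcases hc.eq_or_lt with rfl | hc
  · simp
  have hneg : -c < 0 := by linarith
  have hI : ∫ s : ℝ, c * Real.exp (-c * |s|) = 2 := by
    rw [integral_comp_abs (f := fun s => c * Real.exp (-c * s)), integral_const_mul,
      integral_exp_mul_Ioi hneg]
    simp
    field_simp
  refine ⟨?_, hI.le⟩
  by_contra h
  rw [integral_undef h] at hI
  norm_num at hI

theorem abs_setIntegral_le_of_le {S : Set ℝ} (hS : MeasurableSet S) {h B : ℝ → ℝ} {x L : ℝ}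
    (hL : 0 ≤ L) (hB : Integrable B) (hB0 : ∀ s, 0 ≤ B s)
    (hle : ∀ t ∈ S, |h t| ≤ L * B (t - x)) :
    |∫ t in S, h t| ≤ L * ∫ s, B s := by
  have hi : Integrable fun t => L * B (t - x) := (hB.comp_sub_right x).const_mul L
  have h1 : ‖∫ t in S, h t‖ ≤ ∫ t in S, L * B (t - x) :=
    norm_integral_le_of_norm_le hi.integrableOn
      ((ae_restrict_iff' hS).2 (Filter.Eventually.of_forall hle))
  refine h1.trans ((setIntegral_le_integral hi
    (Filter.Eventually.of_forall fun t => mul_nonneg hL (hB0 _))).trans (le_of_eq ?_))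
  rw [integral_const_mul, integral_sub_right_eq_self B]

/-- Bounds for integrals against the weight over a set lying on the far side of `x` from `m`. -/
theorem abs_setIntegral_mixWeight_le {v : ℝ} (hv : 0 < v) (a b : ℝ) {m x : ℝ} {S : Set ℝ}
    (hS : MeasurableSet S) (hSx : ∀ t ∈ S, 0 ≤ (t - x) * (x - m)) {g : ℝ → ℝ} {K : ℝ}
    (hK : ∀ t, |g t| ≤ K) :
    |∫ t in S, g t * mixWeight a b v m t| ≤
      K * mixWeight a b v m x * ∫ s, envelope |a| v s ∧
    |x - m| / v * |∫ t in S, g t * mixWeight a b v m t| ≤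
      K * mixWeight a b v m x * (2 * Real.exp (a ^ 2 * v / 2)) ∧
    |∫ t in S, g t * ((t - x) / v * mixWeight a b v m t)| ≤
      K * mixWeight a b v m x * ((∫ s, envelope (|a| + 1) v s) / v) := by
  have hK0 : 0 ≤ K := (abs_nonneg _).trans (hK 0)
  have hW := (mixWeight_pos a b v m x).le
  have hg (t : ℝ) (ht : t ∈ S) : |g t * mixWeight a b v m t| ≤ K * mixWeight a b v m x *
      (envelope |a| v (t - x) * Real.exp (-(|x - m| / v) * |t - x|)) := by
    rw [abs_mul, abs_of_pos (mixWeight_pos a b v m t), mul_assoc]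
    exact mul_le_mul (hK t) (mixWeight_le hv a b (hSx t ht)) (mixWeight_pos _ _ _ _ _).le hK0
  have hexp (t : ℝ) : Real.exp (-(|x - m| / v) * |t - x|) ≤ 1 := by
    rw [Real.exp_le_one_iff, neg_mul, neg_nonpos]
    positivity
  have hg' (t : ℝ) (ht : t ∈ S) : |g t * mixWeight a b v m t| ≤ K * mixWeight a b v m x *
      envelope |a| v (t - x) :=
    (hg t ht).trans (mul_le_mul_of_nonneg_left
      (mul_le_of_le_one_right (envelope_pos _ _ _).le (hexp t)) (by positivity))
  refine ⟨abs_setIntegral_le_of_le hS (by positivity) (integrable_envelope hv |a|)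
    (fun s => (envelope_pos _ _ _).le) hg', ?_, ?_⟩
  · have hc : 0 ≤ |x - m| / v := by positivity
    obtain ⟨hi, hle⟩ := integrable_integral_mul_exp_neg_abs hc
    have hcoef : |x - m| / v * |∫ t in S, g t * mixWeight a b v m t| =
        |∫ t in S, |x - m| / v * (g t * mixWeight a b v m t)| := by
      rw [integral_const_mul, abs_mul, abs_of_nonneg hc]
    rw [hcoef]
    refine (abs_setIntegral_le_of_le hS (x := x)
      (L := K * mixWeight a b v m x * Real.exp (a ^ 2 * v / 2)) (by positivity) hi
      (fun s => by positivity) fun t ht => ?_).trans ?_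
    · have henv : envelope |a| v (t - x) ≤ Real.exp (a ^ 2 * v / 2) := by
        rw [envelope, Real.exp_le_exp]
        have h1 : a ^ 2 * v / 2 - (|a| * |t - x| - (t - x) ^ 2 / (2 * v)) =
            (|a| * v - |t - x|) ^ 2 / (2 * v) := by
          rw [← sq_abs (t - x), ← sq_abs a]
          field_simp
          ring
        have h2 : 0 ≤ (|a| * v - |t - x|) ^ 2 / (2 * v) := by positivity
        linarith
      rw [abs_mul, abs_of_nonneg hc]
      calc |x - m| / v * |g t * mixWeight a b v m t|
          ≤ |x - m| / v * (K * mixWeight a b v m x *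
            (Real.exp (a ^ 2 * v / 2) * Real.exp (-(|x - m| / v) * |t - x|))) := by
            refine mul_le_mul_of_nonneg_left ((hg t ht).trans ?_) hc
            gcongr
        _ = _ := by ring
    · refine (mul_le_mul_of_nonneg_left hle (by positivity)).trans (le_of_eq ?_)
      ring
  · have h := abs_setIntegral_le_of_le hS (x := x) (h := fun t => g t * ((t - x) / v *
      mixWeight a b v m t)) (L := K * mixWeight a b v m x / v) (by positivity)
      (integrable_envelope hv (|a| + 1)) (fun s => (envelope_pos _ _ _).le) fun t ht => ?_
    · refine h.trans (le_of_eq ?_)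
      ring
    · calc |g t * ((t - x) / v * mixWeight a b v m t)|
          = |t - x| / v * |g t * mixWeight a b v m t| := by
            rw [abs_mul, abs_mul, abs_mul, abs_div, abs_of_pos hv]
            ring
        _ ≤ |t - x| / v * (K * mixWeight a b v m x * envelope |a| v (t - x)) :=
            mul_le_mul_of_nonneg_left (hg' t ht) (by positivity)
        _ = K * mixWeight a b v m x / v * (|t - x| * envelope |a| v (t - x)) := by ring
        _ ≤ _ := mul_le_mul_of_nonneg_left (abs_mul_envelope_le _ _ _) (by positivity)

theorem hasDerivAt_setIntegral_mixWeight {v : ℝ} (hv : 0 < v) (a b m : ℝ) {S : Set ℝ}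
    (hS : MeasurableSet S) {g : ℝ → ℝ} (hg : Measurable g) {K : ℝ} (hK : ∀ t, |g t| ≤ K) :
    IntegrableOn (fun t => g t * ((t - m) / v * mixWeight a b v m t)) S ∧
    HasDerivAt (fun m => ∫ t in S, g t * mixWeight a b v m t)
      (∫ t in S, g t * ((t - m) / v * mixWeight a b v m t)) m := by
  refine ⟨(hasDerivAt_integral_mixWeight hv a b m hg hK).1.integrableOn, ?_⟩
  have hK0 : 0 ≤ K := (abs_nonneg _).trans (hK 0)
  have h := (hasDerivAt_integral_mixWeight hv a b m (hg.indicator hS) (K := K) fun t => by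
    by_cases ht : t ∈ S
    · simpa [ht] using hK t
    · simpa [ht] using hK0).2
  have hind (w : ℝ → ℝ) : ∫ t, S.indicator g t * w t = ∫ t in S, g t * w t := by
    rw [← integral_indicator hS]
    simp_rw [Set.indicator_mul_left]
  simpa only [hind] using h

/-- Value and parameter-derivative bounds for the Stein solution written as an integral over a
set lying on the far side of `x` from `m`. -/
theorem stein_integral_bounds {v : ℝ} (hv : 0 < v) (a b : ℝ) {m x : ℝ} {S : Set ℝ}
    (hS : MeasurableSet S) (hSx : ∀ t ∈ S, 0 ≤ (t - x) * (x - m)) {u : ℝ → ℝ}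
    (hu : Measurable u) {M : ℝ} (hM : ∀ t, |u t| ≤ M) {r : ℝ → ℝ} {e E : ℝ}
    (hr : HasDerivAt r e m) (hrM : |r m| ≤ M) (he : |e| ≤ E) :
    |(∫ t in S, (u t - r m) * mixWeight a b v m t) / mixWeight a b v m x| ≤
      2 * M * ∫ s, envelope |a| v s ∧
    |x - m| / v * |(∫ t in S, (u t - r m) * mixWeight a b v m t) / mixWeight a b v m x| ≤
      2 * M * (2 * Real.exp (a ^ 2 * v / 2)) ∧
    ∃ d, HasDerivAt
      (fun n => (∫ t in S, (u t - r n) * mixWeight a b v n t) / mixWeight a b v n x) d m ∧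
      |d| ≤ 2 * M * ((∫ s, envelope (|a| + 1) v s) / v) + E * ∫ s, envelope |a| v s := by
  have hW := mixWeight_pos a b v m x
  have hK (t : ℝ) : |u t - r m| ≤ 2 * M := by
    linarith [abs_sub (u t) (r m), hM t]
  have hone : ∀ t : ℝ, |(fun _ => (1 : ℝ)) t| ≤ 1 := by simp
  obtain ⟨h1, h2, h3⟩ := abs_setIntegral_mixWeight_le hv a b hS hSx hK
  obtain ⟨k1, -, -⟩ := abs_setIntegral_mixWeight_le hv a b hS hSx hone
  refine ⟨?_, ?_, ?_⟩
  · rw [abs_div, abs_of_pos hW, div_le_iff₀ hW]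
    linarith
  · rw [abs_div, abs_of_pos hW, ← mul_div_assoc, div_le_iff₀ hW]
    linarith
  · have hintW {g : ℝ → ℝ} (hg : Measurable g) {K : ℝ} (hK : ∀ t, |g t| ≤ K) (n : ℝ) :
        IntegrableOn (fun t => g t * mixWeight a b v n t) S :=
      (integrable_mul_mixWeight hv a b n hg hK).integrableOn
    have hsplit (n : ℝ) : ∫ t in S, (u t - r n) * mixWeight a b v n t =
        (∫ t in S, u t * mixWeight a b v n t) - r n * ∫ t in S, 1 * mixWeight a b v n t := by
      rw [← integral_const_mul, ← integral_sub (hintW hu hM n)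
        ((hintW measurable_const hone n).const_mul _)]
      congr 1
      ext t
      ring
    obtain ⟨iu, du⟩ := hasDerivAt_setIntegral_mixWeight hv a b m hS hu hM
    obtain ⟨i1, d1⟩ := hasDerivAt_setIntegral_mixWeight hv a b m hS
      (g := fun _ => (1 : ℝ)) measurable_const hone
    have hd := (du.fun_sub (hr.fun_mul d1)).fun_div (hasDerivAt_mixWeight_mean a b v m x) hW.ne'
    have hfun : (fun n => (∫ t in S, (u t - r n) * mixWeight a b v n t) /
        mixWeight a b v n x) = fun n => ((∫ t in S, u t * mixWeight a b v n t) -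
          r n * ∫ t in S, 1 * mixWeight a b v n t) / mixWeight a b v n x := by
      ext n
      rw [hsplit]
    have hcomb : ∫ t in S, (u t - r m) * ((t - x) / v * mixWeight a b v m t) =
        (∫ t in S, u t * ((t - m) / v * mixWeight a b v m t)) -
        r m * (∫ t in S, 1 * ((t - m) / v * mixWeight a b v m t)) -
        (x - m) / v * ((∫ t in S, u t * mixWeight a b v m t) -
          r m * ∫ t in S, 1 * mixWeight a b v m t) := by
      rw [← hsplit, ← integral_const_mul, ← integral_const_mul,
        ← integral_sub iu (i1.const_mul (r m)), ← integral_sub (iu.sub' (i1.const_mul (r m)))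
          ((hintW (hu.sub_const (r m)) hK m).const_mul ((x - m) / v))]
      congr 1
      ext t
      ring
    refine ⟨((∫ t in S, (u t - r m) * ((t - x) / v * mixWeight a b v m t)) -
      e * ∫ t in S, 1 * mixWeight a b v m t) / mixWeight a b v m x, ?_, ?_⟩
    · rw [hfun]
      refine hd.congr_deriv ?_
      rw [hcomb]
      field_simp
      ring
    · rw [abs_div, abs_of_pos hW, div_le_iff₀ hW]
      refine (abs_sub _ _).trans ?_
      rw [abs_mul]
      have := mul_le_mul he k1 (abs_nonneg _) ((abs_nonneg _).trans he)
      linarith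

/-- Product rule in integrated form for an indefinite integral and a smooth factor. -/
theorem integral_mul_add_eq_sub {F φ q q' : ℝ → ℝ} (hφ : ∀ x y, IntervalIntegrable φ volume x y)
    (hF : ∀ x y, F x - F y = ∫ t in y..x, φ t) (hq : ∀ x, HasDerivAt q (q' x) x)
    (hq' : Continuous q') (x y : ℝ) :
    F x * q x - F y * q y = ∫ t in y..x, (φ t * q t + F t * q' t) := by
  have hq'i (x y : ℝ) : IntervalIntegrable q' volume x y := hq'.intervalIntegrable x y
  have hFac : AbsolutelyContinuousOnInterval (fun t => ∫ s in y..t, φ s) y x :=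
    (hφ y x).absolutelyContinuousOnInterval_intervalIntegral (by simp)
  have hqac : AbsolutelyContinuousOnInterval (fun t => ∫ s in y..t, q' s) y x :=
    (hq'i y x).absolutelyContinuousOnInterval_intervalIntegral (by simp)
  have h := hFac.integral_deriv_mul_eq_sub hqac
  have hFe (t : ℝ) : F t = F y + ∫ s in y..t, φ s := by rw [← hF]; ring
  have hqe (t : ℝ) : ∫ s in y..t, q' s = q t - q y :=
    intervalIntegral.integral_eq_sub_of_hasDerivAt (fun s _ => hq s) (hq'i y t)
  have h1 : ∫ t in y..x, (φ t * q t + F t * q' t) =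
      ∫ t in y..x, ((deriv (fun t => ∫ s in y..t, φ s) t * (∫ s in y..t, q' s) +
        (∫ s in y..t, φ s) * deriv (fun t => ∫ s in y..t, q' s) t) +
        (q y * φ t + F y * q' t)) := by
    apply intervalIntegral.integral_congr_ae
    filter_upwards [(hφ y x).ae_hasDerivAt_integral] with t ht hmem
    have hd1 := (ht (Set.uIoc_subset_uIcc hmem) y (by simp)).deriv
    have hd2 : deriv (fun t => ∫ s in y..t, q' s) t = q' t := by
      simp_rw [hqe]
      exact ((hq t).sub_const _).deriv
    rw [hd1, hd2, hqe, hFe t]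
    ring
  rw [h1, intervalIntegral.integral_add, h, intervalIntegral.integral_add,
    intervalIntegral.integral_const_mul, intervalIntegral.integral_const_mul, hqe, ← hF]
  · simp only [intervalIntegral.integral_same]
    ring
  · exact (hφ y x).const_mul _
  · exact (hq'i y x).const_mul _
  · exact (hFac.intervalIntegrable_deriv.mul_continuousOn hqac.continuousOn).add
      (hqac.intervalIntegrable_deriv.continuousOn_mul hFac.continuousOn)
  · exact ((hφ y x).const_mul _).add ((hq'i y x).const_mul _)

theorem hasDerivAt_inv_mixWeight (a b v m x : ℝ) :
    HasDerivAt (fun x => (mixWeight a b v m x)⁻¹)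
      (((x - m) / v - a * Real.tanh (a * x + b)) * (mixWeight a b v m x)⁻¹) x := by
  have h1 : HasDerivAt (fun x => a * x + b) a x := by
    simpa using ((hasDerivAt_id x).const_mul a).add_const b
  have h2 : HasDerivAt (fun x => -(x - m) ^ 2 / (2 * v)) (-((x - m) / v)) x := by
    have h := (((hasDerivAt_id' x).sub_const m).fun_pow 2).fun_neg.div_const (2 * v)
    refine h.congr_deriv ?_
    by_cases hv : v = 0
    · simp [hv]
    · field_simp
      simp [mul_comm]
  have h3 := (h1.cosh.fun_mul h2.exp).fun_inv (mixWeight_pos a b v m x).ne'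
  refine h3.congr_deriv ?_
  have hc := (Real.cosh_pos (a * x + b)).ne'
  have he := (Real.exp_pos (-(x - m) ^ 2 / (2 * v))).ne'
  simp only [mixWeight, Real.tanh_eq_sinh_div_cosh]
  generalize Real.exp (-(x - m) ^ 2 / (2 * v)) = w at *
  generalize (x - m) / v = z
  field_simp
  ring


/-- Lemma 1.2: Stein's method for mixtures of two Gaussians.  There is a
solution `f(x,μ)` of the Stein equation (with `f₁ = ∂f/∂x` in the absolutely
continuous sense and `f₂ = ∂f/∂μ`) such that `|f|`, `|∂f/∂x|`, `|∂f/∂μ|` are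
bounded by `C‖u‖_∞`, where `C` depends only on `a` and `σ`. -/
theorem stein_mixture_gaussian (a v : ℝ) (hv : 0 < v) :
    ∃ C : ℝ, 0 < C ∧ ∀ b : ℝ, ∀ u : ℝ → ℝ, Measurable u →
      ∀ M : ℝ, (∀ x, |u x| ≤ M) →
      ∃ f f₁ f₂ : ℝ → ℝ → ℝ,
        (∀ x μ, f₁ x μ - ((x - μ) / v - a * Real.tanh (a * x + b)) * f x μ
            = u x - ∫ t, u t * mixDens a b μ v t) ∧
        (∀ μ x y, f x μ - f y μ = ∫ t in y..x, f₁ t μ) ∧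
        (∀ x μ, HasDerivAt (fun m => f x m) (f₂ x μ) μ) ∧
        (∀ x μ, |f x μ| ≤ C * M ∧ |f₁ x μ| ≤ C * M ∧ |f₂ x μ| ≤ C * M) := by
  set Γ₀ := ∫ s, envelope |a| v s
  set Γ₁ := ∫ s, envelope (|a| + 1) v s
  set B := 2 * (Γ₁ / (v * (Real.sqrt (2 * π) * Real.sqrt v)))
  have hΓ₀ : 0 ≤ Γ₀ := integral_envelope_nonneg _ _
  have hΓ₁ : 0 ≤ Γ₁ := integral_envelope_nonneg _ _
  have hB : 0 ≤ B := by positivity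
  set C₁ := 2 * Γ₀
  set C₂ := 2 + 4 * Real.exp (a ^ 2 * v / 2) + |a| * (2 * Γ₀)
  set C₃ := 2 * (Γ₁ / v) + B * Γ₀
  have hC₁ : 0 ≤ C₁ := by positivity
  have hC₂ : 0 < C₂ := by positivity
  have hC₃ : 0 ≤ C₃ := by positivity
  refine ⟨C₁ + C₂ + C₃, by positivity, fun b u hu M hM => ?_⟩
  have hM0 : 0 ≤ M := (abs_nonneg _).trans (hM 0)
  set r : ℝ → ℝ := fun m => ∫ t, u t * mixDens a b m v t with hr
  set f : ℝ → ℝ → ℝ := fun x m =>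
    (∫ t in Set.Iic x, (u t - r m) * mixWeight a b v m t) / mixWeight a b v m x with hf
  have hrM (m : ℝ) : |r m| ≤ M := (hasDerivAt_mixture_mean hv a b m hu hM).1
  have hintW (m : ℝ) : Integrable fun t => (u t - r m) * mixWeight a b v m t :=
    integrable_mul_mixWeight hv a b m (hu.sub_const _) (K := 2 * M) fun t => by
      linarith [abs_sub (u t) (r m), hM t, hrM m]
  have hzero (m : ℝ) : ∫ t, (u t - r m) * mixWeight a b v m t = 0 := by
    have hZ := integral_mixWeight_pos hv a b m
    simp_rw [sub_mul]
    rw [integral_sub (integrable_mul_mixWeight hv a b m hu hM)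
      (integrable_mul_mixWeight hv a b m measurable_const fun _ => le_rfl), integral_const_mul]
    simp only [hr, mixDens_eq hv, ← mul_div_assoc]
    rw [integral_div, div_mul_cancel₀ _ hZ.ne', sub_self]
  have hIoi (x m : ℝ) : f x m =
      -((∫ t in Set.Ioi x, (u t - r m) * mixWeight a b v m t) / mixWeight a b v m x) := by
    have h := intervalIntegral.integral_Iic_add_Ioi (hintW m).integrableOn
      (hintW m).integrableOn (b := x)
    rw [hzero m] at h
    rw [← neg_div, ← eq_neg_of_add_eq_zero_left h]
  have hbounds (x m : ℝ) : |f x m| ≤ C₁ * M ∧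
      |x - m| / v * |f x m| ≤ 4 * Real.exp (a ^ 2 * v / 2) * M ∧
      ∃ d, HasDerivAt (fun n => f x n) d m ∧ |d| ≤ C₃ * M := by
    obtain ⟨e, he, heB⟩ := (hasDerivAt_mixture_mean hv a b m hu hM).2
    rcases le_total x m with hxm | hxm
    · obtain ⟨h1, h2, d, h3, h4⟩ := stein_integral_bounds hv a b (S := Set.Iic x)
        measurableSet_Iic (fun t ht => mul_nonneg_of_nonpos_of_nonpos (sub_nonpos.2 ht)
          (sub_nonpos.2 hxm)) hu hM he (hrM m) heB
      refine ⟨h1.trans (le_of_eq (by ring)), h2.trans (le_of_eq (by ring)), d, h3,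
        h4.trans (le_of_eq (by ring))⟩
    · obtain ⟨h1, h2, d, h3, h4⟩ := stein_integral_bounds hv a b (S := Set.Ioi x)
        measurableSet_Ioi (fun t ht => mul_nonneg (sub_nonneg.2 (le_of_lt ht))
          (sub_nonneg.2 hxm)) hu hM he (hrM m) heB
      simp_rw [hIoi, abs_neg]
      refine ⟨h1.trans (le_of_eq (by ring)), h2.trans (le_of_eq (by ring)), -d, h3.fun_neg, ?_⟩
      rw [abs_neg]
      exact h4.trans (le_of_eq (by ring))
  refine ⟨f, fun x m => u x - r m + ((x - m) / v - a * Real.tanh (a * x + b)) * f x m,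
    fun x m => deriv (fun n => f x n) m, fun x m => by ring, fun m x y => ?_, fun x m => ?_,
    fun x m => ?_⟩
  · have h := integral_mul_add_eq_sub
      (F := fun x => ∫ t in Set.Iic x, (u t - r m) * mixWeight a b v m t)
      (fun x y => (hintW m).intervalIntegrable)
      (fun x y => intervalIntegral.integral_Iic_sub_Iic (hintW m).integrableOn
        (hintW m).integrableOn)
      (hasDerivAt_inv_mixWeight a b v m) (by
        have hc := (continuous_mixWeight a b v m).inv₀ fun t => (mixWeight_pos a b v m t).ne'
        have ht : Continuous Real.tanh := by
          simp_rw [funext Real.tanh_eq_sinh_div_cosh]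
          exact Real.continuous_sinh.div Real.continuous_cosh fun t => (Real.cosh_pos t).ne'
        exact (by fun_prop : Continuous fun t => (t - m) / v - a * Real.tanh (a * t + b)).mul hc)
      x y
    simp only [hf, div_eq_mul_inv _ (mixWeight a b v m _)]
    rw [h]
    refine intervalIntegral.integral_congr fun t _ => ?_
    have := (mixWeight_pos a b v m t).ne'
    field_simp
  · obtain ⟨d, hd, -⟩ := (hbounds x m).2.2
    exact hd.differentiableAt.hasDerivAt
  · obtain ⟨h1, h2, d, hd, h3⟩ := hbounds x m
    refine ⟨h1.trans ?_, ?_, ?_⟩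
    · gcongr
      linarith
    · have htanh : |Real.tanh (a * x + b)| ≤ 1 :=
        abs_le.2 ⟨(Real.neg_one_lt_tanh _).le, (Real.tanh_lt_one _).le⟩
      have e1 : |a * Real.tanh (a * x + b) * f x m| ≤ |a| * (2 * Γ₀) * M := by
        rw [abs_mul, abs_mul]
        calc |a| * |Real.tanh (a * x + b)| * |f x m| ≤ |a| * 1 * (C₁ * M) := by gcongr
          _ = |a| * (2 * Γ₀) * M := by ring
      have e2 : |(x - m) / v * f x m| ≤ 4 * Real.exp (a ^ 2 * v / 2) * M := by
        rwa [abs_mul, abs_div, abs_of_pos hv]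
      have e3 : |u x - r m| ≤ 2 * M := by linarith [abs_sub (u x) (r m), hM x, hrM m]
      have e4 : |u x - r m + ((x - m) / v - a * Real.tanh (a * x + b)) * f x m| ≤ C₂ * M := by
        rw [sub_mul]
        refine (abs_add_le _ _).trans ((add_le_add e3 ((abs_sub _ _).trans
          (add_le_add e2 e1))).trans (le_of_eq ?_))
        ring
      refine e4.trans ?_
      gcongr
      linarith
    · simp only [hd.deriv]
      refine h3.trans ?_
      gcongr
      linarith

end SK
end
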